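/- arXiv:1605.05232 — 2 statements merged into one kernel-verified Lean document; each statement's English description precedes it below -/
import Mathlib

section
/- Assume the nondegeneracy condition h₀₁² + h₀₂² + h₁₂² ≠ 0 at λ̄ and that r² ≠ h₁₂². Then there exists a neighbourhood O of λ̄ in ℝ³ × ℝ³ such that no time-optimal trajectory admits an extremal that remains in Λ ∩ O throughout some nondegenerate time interval (τ₁, τ₂) with τ₁ < τ₂. -/
noncomputable section

open MeasureTheory Real Set

/-- The state space: ℝ³, realized as `Fin 3 → ℝ`. -/
abbrev E3 : Type := Fin 3 → ℝ

/-- Euclidean inner product on ℝ³. -/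
def dot3 (a b : E3) : ℝ := ∑ i, a i * b i

/-- Lie bracket of two vector fields: `[f, g](x) = Dg(x) f(x) − Df(x) g(x)`. -/
def lie (f g : E3 → E3) : E3 → E3 :=
  fun x => fderiv ℝ g x (f x) - fderiv ℝ f x (g x)

/-- The control set: the closed unit disk in ℝ². -/
def U2 : Set (ℝ × ℝ) := {u | u.1 ^ 2 + u.2 ^ 2 ≤ 1}

/-- An admissible control on the time set `I`: measurable with values in the unit disk.
(Essential boundedness is automatic since `U2` is bounded.) -/
def AdmControl (u : ℝ → ℝ × ℝ) (I : Set ℝ) : Prop :=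
  Measurable u ∧ ∀ t ∈ I, u t ∈ U2

/-- An admissible trajectory of `q̇ = f₀(q) + u₁ f₁(q) + u₂ f₂(q)` on `I`,
with control `u`: locally Lipschitz (here: Lipschitz on `I`) and satisfying
the ODE almost everywhere on `I`. -/
def IsTraj (f0 f1 f2 : E3 → E3) (u : ℝ → ℝ × ℝ) (q : ℝ → E3) (I : Set ℝ) : Prop :=
  (∃ K, LipschitzOnWith K q I) ∧
  ∀ᵐ t, t ∈ I → HasDerivAt q
    (f0 (q t) + (u t).1 • f1 (q t) + (u t).2 • f2 (q t)) t

/-- `q : [0, t₁] → ℝ³` is a time-optimal trajectory: it is an admissible trajectory,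
and no admissible trajectory joins `q 0` to `q t₁` in time strictly less than `t₁`. -/
def TimeOpt (f0 f1 f2 : E3 → E3) (q : ℝ → E3) (t1 : ℝ) : Prop :=
  0 ≤ t1 ∧
  (∃ u, AdmControl u (Icc 0 t1) ∧ IsTraj f0 f1 f2 u q (Icc 0 t1)) ∧
  ¬ ∃ s, 0 ≤ s ∧ s < t1 ∧ ∃ u p, AdmControl u (Icc 0 s) ∧
      IsTraj f0 f1 f2 u p (Icc 0 s) ∧ p 0 = q 0 ∧ p s = q t1

/-- For `λ = (ξ, x)`, the Hamiltonian lift `h_f(λ) = ⟨ξ, f(x)⟩` of a vector field `f`. -/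
def hF (f : E3 → E3) (l : E3 × E3) : ℝ := dot3 l.1 (f l.2)

/-- The (pre-maximized) Hamiltonian `h₀ + v₁ h₁ + v₂ h₂` at `λ`, for a control value `v`. -/
def Ham (f0 f1 f2 : E3 → E3) (v : ℝ × ℝ) (l : E3 × E3) : ℝ :=
  hF f0 l + v.1 * hF f1 l + v.2 * hF f2 l

/-- A Pontryagin extremal `λ(t) = (ξ(t), x(t))` with control `u` on the time set `I`:
locally Lipschitz, `ξ(t) ≠ 0`, satisfying a.e. the Hamiltonian system
`x' = f₀(x) + u₁ f₁(x) + u₂ f₂(x)`,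
`ξ' = −(Df₀(x) + u₁ Df₁(x) + u₂ Df₂(x))ᵀ ξ` (expressed via the inner product),
the maximality condition, and nonnegativity of the maximized Hamiltonian. -/
def IsExtremal (f0 f1 f2 : E3 → E3) (u : ℝ → ℝ × ℝ) (lam : ℝ → E3 × E3)
    (I : Set ℝ) : Prop :=
  (∃ K, LipschitzOnWith K lam I) ∧
  AdmControl u I ∧
  (∀ t ∈ I, (lam t).1 ≠ 0) ∧
  ∀ᵐ t, t ∈ I →
    (HasDerivAt (fun s => (lam s).2)
      (f0 ((lam t).2) + (u t).1 • f1 ((lam t).2) + (u t).2 • f2 ((lam t).2)) t) ∧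
    (∃ w : E3, HasDerivAt (fun s => (lam s).1) w t ∧
      ∀ v : E3, dot3 w v =
        - dot3 ((lam t).1)
          (fderiv ℝ f0 ((lam t).2) v + (u t).1 • fderiv ℝ f1 ((lam t).2) v
            + (u t).2 • fderiv ℝ f2 ((lam t).2) v)) ∧
    (∀ v ∈ U2, Ham f0 f1 f2 v (lam t) ≤ Ham f0 f1 f2 (u t) (lam t)) ∧
    0 ≤ Ham f0 f1 f2 (u t) (lam t)

/-- The singular locus `Λ = {(ξ, x) : ⟨ξ, f₁(x)⟩ = ⟨ξ, f₂(x)⟩ = 0}`. -/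
def SingLocus (f1 f2 : E3 → E3) : Set (E3 × E3) :=
  {l | hF f1 l = 0 ∧ hF f2 l = 0}

/-- A curve that is absolutely continuous on `[0, 1]` and whose derivative is a.e. bounded by `c`
moves by at most `c * r` in time `r`. -/
lemma abs_sub_le_of_ae_deriv_bound {f f' : ℝ → ℝ} {c : ℝ}
    (hf : AbsolutelyContinuousOnInterval f 0 1)
    (h : ∀ᵐ r, r ∈ Icc (0 : ℝ) 1 → HasDerivAt f (f' r) r ∧ |f' r| ≤ c)
    {r : ℝ} (hr : r ∈ Icc (0 : ℝ) 1) : |f r - f 0| ≤ c * r := by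
  have hac : AbsolutelyContinuousOnInterval f 0 r := by
    refine hf.mono ?_
    rw [uIcc_of_le hr.1, uIcc_of_le zero_le_one]
    exact Icc_subset_Icc_right hr.2
  rw [← hac.integral_deriv_eq_sub]
  have := intervalIntegral.norm_integral_le_of_norm_le_const_ae (f := deriv f) (a := 0) (b := r)
    (C := c) ?_
  · simpa [abs_of_nonneg hr.1] using this
  · filter_upwards [h] with x hx hxI
    rw [uIoc_of_le hr.1] at hxI
    obtain ⟨h1, h2⟩ := hx ⟨hxI.1.le, hxI.2.trans hr.2⟩
    rwa [h1.deriv]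

lemma abs_mul_le_of_abs_le {a b A B : ℝ} (ha : |a| ≤ A) (hb : |b| ≤ B) : |a * b| ≤ A * B := by
  rw [abs_mul]
  exact mul_le_mul ha hb (abs_nonneg _) ((abs_nonneg _).trans ha)

/-- The area-type remainder of the endpoint expansion along the perturbation `(e₁, e₂)`. -/
def areaRate (a1 a2 b1 b2 c1 c2 aV bV V1 V2 e1 e2 d2 : ℝ) : ℝ :=
  c1 * e1 + c2 * e2 + (a1 * e1 + a2 * e2) * V1 + (b1 * e1 + b2 * e2) * V2 - aV * e1 - bV * e2
    + (b1 - a2) * (e1 * d2)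

section RateBounds

variable {a1 a2 a3 b1 b2 b3 c0 c1 c2 c3 M ε τ σ V1 V2 d1 d2 x y w Av Bv Cv : ℝ}

lemma abs_linear_form_le (h1 : |a1| ≤ M) (h2 : |a2| ≤ M) (h3 : |a3| ≤ M) (hM : 1 ≤ M)
    (hx : |x| ≤ 2 * M * τ) (hy : |y| ≤ 2 * M * τ) (hw : |w| ≤ 2 * M * τ)
    (hετ : ε * τ ≤ τ) (hτ : 0 < τ)
    (hR : |Av - (a1 * x + a2 * y + a3 * w)| ≤ ε * τ) : |Av| ≤ 7 * M ^ 2 * τ := by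
  have e1 := abs_mul_le_of_abs_le h1 hx
  have e2 := abs_mul_le_of_abs_le h2 hy
  have e3 := abs_mul_le_of_abs_le h3 hw
  have e : |a1 * x + a2 * y + a3 * w| ≤ 6 * M ^ 2 * τ := by
    refine (abs_add_three _ _ _).trans ?_
    linarith
  have h' : |Av| ≤ |Av - (a1 * x + a2 * y + a3 * w)| + |a1 * x + a2 * y + a3 * w| := by
    simpa using abs_add_le (Av - (a1 * x + a2 * y + a3 * w)) (a1 * x + a2 * y + a3 * w)
  have : 1 * τ ≤ M ^ 2 * τ := by gcongr; nlinarith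
  linarith

lemma abs_speed_le (hτ : 0 < τ) (hV1 : |V1| ≤ M) (hd1 : |d1| ≤ M) :
    |τ * (V1 + d1)| ≤ τ * (2 * M) := by
  rw [abs_mul, abs_of_pos hτ]
  exact mul_le_mul_of_nonneg_left ((abs_add_le _ _).trans (by linarith)) hτ.le

lemma abs_first_order_rate_le (hM : 1 ≤ M) (hc0 : |c0| ≤ M)
    (hV1 : |V1| ≤ M) (hV2 : |V2| ≤ M) (hd1 : |d1| ≤ M) (hd2 : |d2| ≤ M) (hτ : 0 < τ)
    (hτ1 : τ ≤ 1) (hσ : |σ - 1| ≤ τ ^ 2) (hA : |Av| ≤ 7 * M ^ 2 * τ)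
    (hB : |Bv| ≤ 7 * M ^ 2 * τ) (hC : |Cv - c0| ≤ 7 * M ^ 2 * τ) :
    |τ * σ * Cv + Av * (τ * (V1 + d1)) + Bv * (τ * (V2 + d2)) - τ * c0|
      ≤ 43 * M ^ 3 * τ ^ 2 := by
  have hM2 : M ≤ M ^ 2 := by nlinarith
  have hM3 : M ^ 2 ≤ M ^ 3 := by nlinarith [sq_nonneg M]
  have hC'' : |Cv| ≤ 8 * M ^ 2 := by
    have := abs_sub_abs_le_abs_sub Cv c0
    nlinarith
  have u1 := abs_mul_le_of_abs_le hA (abs_speed_le hτ hV1 hd1)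
  have u2 := abs_mul_le_of_abs_le hB (abs_speed_le hτ hV2 hd2)
  have u3 := abs_mul_le_of_abs_le (abs_of_pos hτ).le (abs_mul_le_of_abs_le hσ hC'')
  have u4 := abs_mul_le_of_abs_le (abs_of_pos hτ).le hC
  have e : τ * σ * Cv + Av * (τ * (V1 + d1)) + Bv * (τ * (V2 + d2)) - τ * c0
      = τ * ((σ - 1) * Cv) + τ * (Cv - c0) + Av * (τ * (V1 + d1)) + Bv * (τ * (V2 + d2)) := by
    ring
  rw [e]
  have e3 : τ * (τ ^ 2 * (8 * M ^ 2)) ≤ 1 * (τ ^ 2 * (8 * M ^ 3)) := by gcongr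
  have e4 : τ * (7 * M ^ 2 * τ) ≤ τ * (7 * M ^ 3 * τ) := by gcongr
  have h1 := abs_add_le (τ * ((σ - 1) * Cv) + τ * (Cv - c0) + Av * (τ * (V1 + d1)))
    (Bv * (τ * (V2 + d2)))
  have h2 := abs_add_three (τ * ((σ - 1) * Cv)) (τ * (Cv - c0)) (Av * (τ * (V1 + d1)))
  linarith

lemma abs_second_order_rate_le {ζ g : ℝ} (hM : 1 ≤ M) (ha3 : |a3| ≤ M) (hb3 : |b3| ≤ M)
    (hc0 : |c0| ≤ M) (hc3 : |c3| ≤ M)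
    (hV1 : |V1| ≤ M) (hV2 : |V2| ≤ M) (hd1 : |d1| ≤ M) (hd2 : |d2| ≤ M) (hτ : 0 < τ)
    (hτε : τ ≤ ε) (hε : ε ≤ 1) (hσ : |σ - 1| ≤ τ ^ 2) (hζ : |ζ| ≤ 43 * M ^ 3 * τ ^ 2)
    (hA : |Av| ≤ ε * τ) (hB : |Bv| ≤ ε * τ) (hC : |x| ≤ ε * τ)
    (hC' : |Cv - c0| ≤ 7 * M ^ 2 * τ) (hg : |g| ≤ ε) :
    |τ * ((σ - 1) * Cv) + τ * (c3 * ζ + x) + (a3 * ζ + Av) * (τ * (V1 + d1))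
        + (b3 * ζ + Bv) * (τ * (V2 + d2)) - τ ^ 2 * g|
      ≤ (8 * M ^ 2 + 43 * M ^ 4 + 2 + 172 * M ^ 5 + 4 * M) * (ε * τ ^ 2) := by
  have hC'' : |Cv| ≤ 8 * M ^ 2 := by
    have := abs_sub_abs_le_abs_sub Cv c0
    nlinarith
  have v3 := abs_mul_le_of_abs_le hc3 hζ
  have v1 := abs_mul_le_of_abs_le ha3 hζ
  have v2 := abs_mul_le_of_abs_le hb3 hζ
  have hM4 : M ^ 4 * (τ * τ) ≤ M ^ 4 * (ε * τ) := by gcongr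
  have hs : M * (43 * M ^ 3 * τ ^ 2) + ε * τ ≤ (43 * M ^ 4 + 1) * (ε * τ) := by linarith
  have hs' {k R : ℝ} (h : |k * ζ| ≤ M * (43 * M ^ 3 * τ ^ 2)) (hR : |R| ≤ ε * τ) :
      |k * ζ + R| ≤ (43 * M ^ 4 + 1) * (ε * τ) :=
    ((abs_add_le _ _).trans (add_le_add h hR)).trans hs
  have u3 := abs_mul_le_of_abs_le (abs_of_pos hτ).le (abs_mul_le_of_abs_le hσ hC'')
  have u4 := abs_mul_le_of_abs_le (abs_of_pos hτ).le (hs' v3 hC)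
  have u1 := abs_mul_le_of_abs_le (hs' v1 hA) (abs_speed_le hτ hV1 hd1)
  have u2 := abs_mul_le_of_abs_le (hs' v2 hB) (abs_speed_le hτ hV2 hd2)
  have u5 := abs_mul_le_of_abs_le (abs_of_nonneg (sq_nonneg τ)).le hg
  have w3 : τ * (τ ^ 2 * (8 * M ^ 2)) ≤ ε * (τ ^ 2 * (8 * M ^ 2)) := by gcongr
  have h0 := abs_sub (τ * ((σ - 1) * Cv) + τ * (c3 * ζ + x) + (a3 * ζ + Av) * (τ * (V1 + d1))
        + (b3 * ζ + Bv) * (τ * (V2 + d2))) (τ ^ 2 * g)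
  have h1 := abs_add_le (τ * ((σ - 1) * Cv) + τ * (c3 * ζ + x)
    + (a3 * ζ + Av) * (τ * (V1 + d1))) ((b3 * ζ + Bv) * (τ * (V2 + d2)))
  have h2 := abs_add_three (τ * ((σ - 1) * Cv)) (τ * (c3 * ζ + x))
    ((a3 * ζ + Av) * (τ * (V1 + d1)))
  linarith

end RateBounds

/-- Second-order expansion of the endpoint of `z' = τ σ C + A x' + B y'` on `[0, 1]` along the
planar curve `(x, y) = τ (r V + e)`, in terms of the first-order data of `A`, `B`, `C`. -/
lemma endpoint_expansion {a1 a2 a3 b1 b2 b3 c0 c1 c2 c3 M ε τ σ V1 V2 aV bV : ℝ}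
    {A B C : ℝ → ℝ → ℝ → ℝ} {e1 e2 d1 d2 z G G' : ℝ → ℝ}
    (hM : 1 ≤ M) (ha1 : |a1| ≤ M) (ha2 : |a2| ≤ M) (ha3 : |a3| ≤ M)
    (hb1 : |b1| ≤ M) (hb2 : |b2| ≤ M) (hb3 : |b3| ≤ M)
    (hc0 : |c0| ≤ M) (hc1 : |c1| ≤ M) (hc2 : |c2| ≤ M) (hc3 : |c3| ≤ M)
    (hV1 : |V1| ≤ M) (hV2 : |V2| ≤ M) (hτ : 0 < τ) (hτε : τ ≤ ε) (hε : ε ≤ 1)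
    (hσ : |σ - 1| ≤ τ ^ 2)
    (haV : aV = a1 * V1 + a2 * V2 + a3 * c0) (hbV : bV = b1 * V1 + b2 * V2 + b3 * c0)
    (hA : ∀ x y w, |x| ≤ 2 * M * τ → |y| ≤ 2 * M * τ → |w| ≤ 2 * M * τ →
      |A x y w - (a1 * x + a2 * y + a3 * w)| ≤ ε * τ)
    (hB : ∀ x y w, |x| ≤ 2 * M * τ → |y| ≤ 2 * M * τ → |w| ≤ 2 * M * τ →
      |B x y w - (b1 * x + b2 * y + b3 * w)| ≤ ε * τ)
    (hC : ∀ x y w, |x| ≤ 2 * M * τ → |y| ≤ 2 * M * τ → |w| ≤ 2 * M * τ →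
      |C x y w - (c0 + c1 * x + c2 * y + c3 * w)| ≤ ε * τ)
    (he1 : AbsolutelyContinuousOnInterval e1 0 1) (he2 : AbsolutelyContinuousOnInterval e2 0 1)
    (hz : AbsolutelyContinuousOnInterval z 0 1) (hG : AbsolutelyContinuousOnInterval G 0 1)
    (he10 : e1 0 = 0) (he20 : e2 0 = 0) (he11 : e1 1 = 0) (he21 : e2 1 = 0)
    (hz0 : z 0 = 0) (hG0 : G 0 = 0)
    (hbd : ∀ r ∈ Icc (0 : ℝ) 1, |e1 r| ≤ M ∧ |e2 r| ≤ M ∧ |z r| ≤ 2 * M * τ)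
    (hd : ∀ᵐ r, r ∈ Icc (0 : ℝ) 1 → HasDerivAt e1 (d1 r) r ∧ HasDerivAt e2 (d2 r) r ∧
      HasDerivAt G (G' r) r ∧ |d1 r| ≤ M ∧ |d2 r| ≤ M ∧
      |G' r - areaRate a1 a2 b1 b2 c1 c2 aV bV V1 V2 (e1 r) (e2 r) (d2 r)| ≤ ε ∧
      HasDerivAt z (τ * σ * C (τ * (r * V1 + e1 r)) (τ * (r * V2 + e2 r)) (z r)
        + A (τ * (r * V1 + e1 r)) (τ * (r * V2 + e2 r)) (z r) * (τ * (V1 + d1 r))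
        + B (τ * (r * V1 + e1 r)) (τ * (r * V2 + e2 r)) (z r) * (τ * (V2 + d2 r))) r) :
    |z 1 - (τ * c0 + τ ^ 2 * ((c1 * V1 + c2 * V2 + c3 * c0 + aV * V1 + bV * V2) / 2 + G 1))|
      ≤ (8 * M ^ 2 + 43 * M ^ 4 + 2 + 172 * M ^ 5 + 4 * M) * (ε * τ ^ 2) := by
  have hτ1 : τ ≤ 1 := hτε.trans hε
  have hM0 : 0 ≤ M := by linarith
  have hετ : ε * τ ≤ τ := by nlinarith
  have hP (V e r : ℝ) (hV : |V| ≤ M) (he : |e| ≤ M) (hr : r ∈ Icc (0 : ℝ) 1) :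
      |τ * (r * V + e)| ≤ 2 * M * τ := by
    have h1 : |r * V| ≤ 1 * M := abs_mul_le_of_abs_le (by rw [abs_of_nonneg hr.1]; exact hr.2) hV
    have h2 : |r * V + e| ≤ 2 * M := (abs_add_le _ _).trans (by linarith)
    rw [abs_mul, abs_of_pos hτ]
    nlinarith
  have hid : AbsolutelyContinuousOnInterval (fun r : ℝ ↦ r) 0 1 :=
    (LipschitzWith.id.lipschitzOnWith (s := uIcc (0 : ℝ) 1)).absolutelyContinuousOnInterval
  -- first-order bound
  have hz1 : ∀ r ∈ Icc (0 : ℝ) 1, |z r - τ * c0 * r| ≤ 43 * M ^ 3 * τ ^ 2 := by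
    intro r hr
    have key := abs_sub_le_of_ae_deriv_bound (f := fun r ↦ z r - τ * c0 * r)
      (f' := fun r ↦ τ * σ * C (τ * (r * V1 + e1 r)) (τ * (r * V2 + e2 r)) (z r)
        + A (τ * (r * V1 + e1 r)) (τ * (r * V2 + e2 r)) (z r) * (τ * (V1 + d1 r))
        + B (τ * (r * V1 + e1 r)) (τ * (r * V2 + e2 r)) (z r) * (τ * (V2 + d2 r)) - τ * c0 * 1)
      (c := 43 * M ^ 3 * τ ^ 2) (hz.sub (hid.const_mul (τ * c0))) ?_ hr
    · simp only [hz0, mul_zero, sub_zero] at key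
      refine key.trans ?_
      have : 0 ≤ 43 * M ^ 3 * τ ^ 2 := by positivity
      nlinarith [hr.1, hr.2]
    filter_upwards [hd] with r hd hr
    obtain ⟨-, -, -, hd1, hd2, -, hdz⟩ := hd hr
    obtain ⟨hr1, hr2, hrz⟩ := hbd r hr
    refine ⟨hdz.sub ((hasDerivAt_id' r).const_mul (τ * c0)), ?_⟩
    have hx := hP V1 _ r hV1 hr1 hr
    have hy := hP V2 _ r hV2 hr2 hr
    have hAv := hA _ _ _ hx hy hrz
    have hBv := hB _ _ _ hx hy hrz
    have hCv := hC _ _ _ hx hy hrz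
    rw [mul_one]
    exact abs_first_order_rate_le hM hc0 hV1 hV2 hd1 hd2 hτ hτ1 hσ
      (abs_linear_form_le ha1 ha2 ha3 hM hx hy hrz hετ hτ hAv)
      (abs_linear_form_le hb1 hb2 hb3 hM hx hy hrz hετ hτ hBv)
      (abs_linear_form_le hc1 hc2 hc3 hM hx hy hrz hετ hτ (by convert hCv using 2; ring))
  -- second-order bound
  have key := abs_sub_le_of_ae_deriv_bound
    (f := fun r ↦ z r - (τ * c0 * r + τ ^ 2 *
      ((c1 * V1 + c2 * V2 + c3 * c0 + aV * V1 + bV * V2) / 2 * (r * r) + aV * (r * e1 r)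
        + bV * (r * e2 r) + a1 / 2 * (e1 r * e1 r) + b2 / 2 * (e2 r * e2 r)
        + a2 * (e1 r * e2 r) + G r)))
    (f' := fun r ↦ τ * σ * C (τ * (r * V1 + e1 r)) (τ * (r * V2 + e2 r)) (z r)
        + A (τ * (r * V1 + e1 r)) (τ * (r * V2 + e2 r)) (z r) * (τ * (V1 + d1 r))
        + B (τ * (r * V1 + e1 r)) (τ * (r * V2 + e2 r)) (z r) * (τ * (V2 + d2 r))
        - (τ * c0 * 1 + τ ^ 2 *
      ((c1 * V1 + c2 * V2 + c3 * c0 + aV * V1 + bV * V2) / 2 * (1 * r + r * 1)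
        + aV * (1 * e1 r + r * d1 r)
        + bV * (1 * e2 r + r * d2 r) + a1 / 2 * (d1 r * e1 r + e1 r * d1 r)
        + b2 / 2 * (d2 r * e2 r + e2 r * d2 r)
        + a2 * (d1 r * e2 r + e1 r * d2 r) + G' r)))
    (c := (8 * M ^ 2 + 43 * M ^ 4 + 2 + 172 * M ^ 5 + 4 * M) * (ε * τ ^ 2)) ?_ ?_
    (right_mem_Icc.2 zero_le_one)
  · simp only [hz0, hG0, he10, he20, he11, he21, mul_zero, sub_zero, mul_one, add_zero] at key
    exact key
  · exact hz.sub ((hid.const_mul _).add (((((((((hid.mul hid).const_mul _).add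
      ((hid.mul he1).const_mul _)).add ((hid.mul he2).const_mul _)).add
      ((he1.mul he1).const_mul _)).add ((he2.mul he2).const_mul _)).add
      ((he1.mul he2).const_mul _)).add hG).const_mul _))
  filter_upwards [hd] with r hd hr
  obtain ⟨hde1, hde2, hdG, hd1, hd2, hGr, hdz⟩ := hd hr
  obtain ⟨hr1, hr2, hrz⟩ := hbd r hr
  have hi := hasDerivAt_id' r
  refine ⟨hdz.sub ((hi.const_mul _).add (((((((((hi.mul hi).const_mul _).add
      ((hi.mul hde1).const_mul _)).add ((hi.mul hde2).const_mul _)).add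
      ((hde1.mul hde1).const_mul _)).add ((hde2.mul hde2).const_mul _)).add
      ((hde1.mul hde2).const_mul _)).add hdG).const_mul _)), ?_⟩
  have hx := hP V1 _ r hV1 hr1 hr
  have hy := hP V2 _ r hV2 hr2 hr
  have hζ := hz1 r hr
  have hAv := hA _ _ _ hx hy hrz
  have hBv := hB _ _ _ hx hy hrz
  have hCv := hC _ _ _ hx hy hrz
  have hC' : |C (τ * (r * V1 + e1 r)) (τ * (r * V2 + e2 r)) (z r) - c0| ≤ 7 * M ^ 2 * τ :=
    abs_linear_form_le hc1 hc2 hc3 hM hx hy hrz hετ hτ (by convert hCv using 2; ring)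
  generalize A (τ * (r * V1 + e1 r)) (τ * (r * V2 + e2 r)) (z r) = Av at hAv
  generalize B (τ * (r * V1 + e1 r)) (τ * (r * V2 + e2 r)) (z r) = Bv at hBv
  generalize C (τ * (r * V1 + e1 r)) (τ * (r * V2 + e2 r)) (z r) = Cv at hCv hC'
  have e : τ * σ * Cv + Av * (τ * (V1 + d1 r)) + Bv * (τ * (V2 + d2 r))
        - (τ * c0 * 1 + τ ^ 2 *
      ((c1 * V1 + c2 * V2 + c3 * c0 + aV * V1 + bV * V2) / 2 * (1 * r + r * 1)
        + aV * (1 * e1 r + r * d1 r)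
        + bV * (1 * e2 r + r * d2 r) + a1 / 2 * (d1 r * e1 r + e1 r * d1 r)
        + b2 / 2 * (d2 r * e2 r + e2 r * d2 r)
        + a2 * (d1 r * e2 r + e1 r * d2 r) + G' r))
      = τ * ((σ - 1) * Cv) + τ * (c3 * (z r - τ * c0 * r) + (Cv - (c0
        + c1 * (τ * (r * V1 + e1 r)) + c2 * (τ * (r * V2 + e2 r)) + c3 * z r)))
        + (a3 * (z r - τ * c0 * r) + (Av - (a1 * (τ * (r * V1 + e1 r))
          + a2 * (τ * (r * V2 + e2 r)) + a3 * z r))) * (τ * (V1 + d1 r))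
        + (b3 * (z r - τ * c0 * r) + (Bv - (b1 * (τ * (r * V1 + e1 r))
          + b2 * (τ * (r * V2 + e2 r)) + b3 * z r))) * (τ * (V2 + d2 r))
        - τ ^ 2 * (G' r
          - areaRate a1 a2 b1 b2 c1 c2 aV bV V1 V2 (e1 r) (e2 r) (d2 r)) := by
    rw [areaRate, haV, hbV]
    ring
  rw [e]
  exact abs_second_order_rate_le hM ha3 hb3 hc0 hc3 hV1 hV2 hd1 hd2 hτ hτε hε hσ hζ hAv hBv hCv
    (by assumption) hGr

/-- Solutions on `[0, 1]` of a bounded scalar equation depending Lipschitz-continuously on the state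
and on a parameter have endpoints depending continuously on the parameter. -/
lemma exists_solution_family {F : ℝ → ℝ → ℝ → ℝ} {K L : ℝ} (hK : 0 ≤ K) (hL : 0 ≤ L)
    (hF : ∀ r ∈ Icc (0 : ℝ) 1, ∀ θ ∈ Icc (-1 : ℝ) 1, ∀ θ' ∈ Icc (-1 : ℝ) 1, ∀ z z',
      |F r z θ - F r z' θ'| ≤ K * (|z - z'| + |θ - θ'|))
    (hc : ∀ θ ∈ Icc (-1 : ℝ) 1, ∀ z, ContinuousOn (fun r ↦ F r z θ) (Icc 0 1))
    (hb : ∀ r ∈ Icc (0 : ℝ) 1, ∀ θ ∈ Icc (-1 : ℝ) 1, ∀ z, |F r z θ| ≤ L) :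
    ∃ Z : ℝ → ℝ → ℝ, (∀ θ ∈ Icc (-1 : ℝ) 1, Z θ 0 = 0 ∧
      ∀ r ∈ Icc (0 : ℝ) 1, HasDerivWithinAt (Z θ) (F r (Z θ r) θ) (Icc 0 1) r) ∧
      ContinuousOn (fun θ ↦ Z θ 1) (Icc (-1) 1) := by
  have hlip (r) (hr : r ∈ Icc (0 : ℝ) 1) (θ) (hθ : θ ∈ Icc (-1 : ℝ) 1) (s : Set ℝ) :
      LipschitzOnWith K.toNNReal (fun z ↦ F r z θ) s := by
    refine LipschitzOnWith.of_dist_le_mul fun z _ z' _ ↦ ?_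
    simpa [Real.dist_eq, Real.coe_toNNReal K hK] using hF r hr θ hθ θ hθ z z'
  have hex (θ) (hθ : θ ∈ Icc (-1 : ℝ) 1) : ∃ α : ℝ → ℝ, α 0 = 0 ∧
      ∀ r ∈ Icc (0 : ℝ) 1, HasDerivWithinAt α (F r (α r) θ) (Icc 0 1) r := by
    have hpl : IsPicardLindelof (fun r z ↦ F r z θ) (tmin := 0) (tmax := 1)
        ⟨0, left_mem_Icc.2 zero_le_one⟩ 0 L.toNNReal 0 L.toNNReal K.toNNReal :=
      { lipschitzOnWith := fun r hr ↦ hlip r hr θ hθ _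
        continuousOn := fun z _ ↦ hc θ hθ z
        norm_le := fun r hr z _ ↦ by
          simpa [Real.coe_toNNReal L hL] using hb r hr θ hθ z
        mul_max_le := by simp }
    exact hpl.exists_eq_forall_mem_Icc_hasDerivWithinAt₀
  choose! Z hZ using hex
  refine ⟨Z, hZ, ?_⟩
  have hcont (θ) (hθ : θ ∈ Icc (-1 : ℝ) 1) : ContinuousOn (Z θ) (Icc 0 1) :=
    fun r hr ↦ ((hZ θ hθ).2 r hr).continuousWithinAt
  have hder (θ) (hθ : θ ∈ Icc (-1 : ℝ) 1) (r) (hr : r ∈ Ico (0 : ℝ) 1) :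
      HasDerivWithinAt (Z θ) (F r (Z θ r) θ) (Ici r) r :=
    ((hZ θ hθ).2 r ⟨hr.1, hr.2.le⟩).mono_of_mem_nhdsWithin (Icc_mem_nhdsGE_of_mem hr)
  have hg (θ) (hθ : θ ∈ Icc (-1 : ℝ) 1) (θ') (hθ' : θ' ∈ Icc (-1 : ℝ) 1) :
      dist (Z θ 1) (Z θ' 1) ≤ gronwallBound 0 K (0 + K * |θ' - θ|) (1 - 0) := by
    have := dist_le_of_approx_trajectories_ODE_of_mem (v := fun r z ↦ F r z θ)
      (s := fun _ ↦ univ) (K := K.toNNReal) (εf := 0) (εg := K * |θ' - θ|) (δ := 0)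
      (fun r hr ↦ hlip r ⟨hr.1, hr.2.le⟩ θ hθ _) (hcont θ hθ) (hder θ hθ)
      (fun r _ ↦ by simp) (fun _ _ ↦ mem_univ _) (hcont θ' hθ') (hder θ' hθ')
      (fun r hr ↦ by
        simpa [Real.dist_eq] using hF r ⟨hr.1, hr.2.le⟩ θ' hθ' θ hθ (Z θ' r) (Z θ' r))
      (fun _ _ ↦ mem_univ _) (by simp [(hZ θ hθ).1, (hZ θ' hθ').1]) 1
      (right_mem_Icc.2 zero_le_one)
    rwa [Real.coe_toNNReal K hK] at this
  intro θ hθ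
  rw [ContinuousWithinAt, tendsto_iff_dist_tendsto_zero]
  have hlim : Filter.Tendsto (fun θ' ↦ gronwallBound 0 K (0 + K * |θ' - θ|) (1 - 0))
      (nhdsWithin θ (Icc (-1) 1)) (nhds 0) := by
    have h1 : Continuous fun θ' ↦ gronwallBound 0 K (0 + K * |θ' - θ|) (1 - 0) :=
      (gronwallBound_continuous_ε 0 K (1 - 0)).comp (by fun_prop)
    have h2 := (h1.tendsto θ).mono_left (nhdsWithin_le_nhds (s := Icc (-1 : ℝ) 1))
    simpa [gronwallBound_ε0_δ0] using h2
  refine squeeze_zero' (Filter.Eventually.of_forall fun _ ↦ dist_nonneg) ?_ hlim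
  filter_upwards [self_mem_nhdsWithin] with θ' hθ'
  rw [dist_comm]
  exact hg _ hθ _ (by assumption)

/-- First-order data of three functions `A`, `B`, `C` at the origin of `ℝ³`, with a common bound
`M` on the coefficients and accuracy `ε * τ` on the cube of half-side `2 * M * τ`. -/
structure FirstOrderData (A B C : ℝ → ℝ → ℝ → ℝ)
    (a1 a2 a3 b1 b2 b3 c0 c1 c2 c3 M ε τ : ℝ) : Prop where
  one_le : 1 ≤ M
  a1_le : |a1| ≤ M
  a2_le : |a2| ≤ M
  a3_le : |a3| ≤ M
  b1_le : |b1| ≤ M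
  b2_le : |b2| ≤ M
  b3_le : |b3| ≤ M
  c0_le : |c0| ≤ M
  c1_le : |c1| ≤ M
  c2_le : |c2| ≤ M
  c3_le : |c3| ≤ M
  pos : 0 < τ
  le_acc : τ ≤ ε
  acc_le : ε ≤ 1
  approxA : ∀ x y w, |x| ≤ 2 * M * τ → |y| ≤ 2 * M * τ → |w| ≤ 2 * M * τ →
      |A x y w - (a1 * x + a2 * y + a3 * w)| ≤ ε * τ
  approxB : ∀ x y w, |x| ≤ 2 * M * τ → |y| ≤ 2 * M * τ → |w| ≤ 2 * M * τ →
      |B x y w - (b1 * x + b2 * y + b3 * w)| ≤ ε * τ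
  approxC : ∀ x y w, |x| ≤ 2 * M * τ → |y| ≤ 2 * M * τ → |w| ≤ 2 * M * τ →
      |C x y w - (c0 + c1 * x + c2 * y + c3 * w)| ≤ ε * τ

/-- The constant in front of the second-order error of `endpoint_expansion`. -/
def expansionConst (M : ℝ) : ℝ := 8 * M ^ 2 + 43 * M ^ 4 + 2 + 172 * M ^ 5 + 4 * M

/-- The endpoint of the contact curve over a straight segment, up to second order. -/
def segmentEndpoint (a1 a2 a3 b1 b2 b3 c0 c1 c2 c3 V1 V2 τ : ℝ) : ℝ :=
  τ * c0 + τ ^ 2 * ((c1 * V1 + c2 * V2 + c3 * c0 + (a1 * V1 + a2 * V2 + a3 * c0) * V1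
    + (b1 * V1 + b2 * V2 + b3 * c0) * V2) / 2)

lemma ae_comp_mul_left {P : ℝ → Prop} {τ : ℝ} (hτ : 0 < τ) (h : ∀ᵐ t, t ∈ Icc 0 τ → P t) :
    ∀ᵐ r, r ∈ Icc (0 : ℝ) 1 → P (τ * r) := by
  have hq : Measure.QuasiMeasurePreserving (fun r : ℝ ↦ τ * r) volume volume :=
    ⟨measurable_const_mul τ, by
      rw [Real.map_volume_mul_left hτ.ne']
      exact Measure.smul_absolutelyContinuous⟩
  filter_upwards [hq.ae h] with r hr hrI
  exact hr ⟨by nlinarith [hrI.1], by nlinarith [hrI.2]⟩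

lemma absolutelyContinuous_comp_mul_left {f : ℝ → ℝ} {L : NNReal} {τ : ℝ} (hτ : 0 < τ)
    (h : LipschitzOnWith L f (Icc 0 τ)) :
    AbsolutelyContinuousOnInterval (fun r ↦ f (τ * r)) 0 1 := by
  have hl : LipschitzOnWith (L * τ.toNNReal) (fun r ↦ f (τ * r)) (uIcc 0 1) := by
    rw [uIcc_of_le zero_le_one]
    refine h.comp (LipschitzOnWith.of_dist_le_mul fun x _ y _ ↦ ?_) fun r hr ↦
      ⟨by nlinarith [hr.1], by nlinarith [hr.2]⟩
    rw [Real.dist_eq, Real.dist_eq, ← mul_sub, abs_mul, abs_of_pos hτ, Real.coe_toNNReal _ hτ.le]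
  exact hl.absolutelyContinuousOnInterval

lemma abs_areaRate_le {a1 a2 b1 b2 c1 c2 aV bV V1 V2 e1 e2 d2 M ν : ℝ} (hM : 1 ≤ M)
    (ha1 : |a1| ≤ M) (ha2 : |a2| ≤ M) (hb1 : |b1| ≤ M) (hb2 : |b2| ≤ M) (hc1 : |c1| ≤ M)
    (hc2 : |c2| ≤ M) (haV : |aV| ≤ 3 * M ^ 2) (hbV : |bV| ≤ 3 * M ^ 2) (hV1 : |V1| ≤ M)
    (hV2 : |V2| ≤ M) (he1 : |e1| ≤ ν) (he2 : |e2| ≤ ν) (hd2 : |d2| ≤ M) :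
    |areaRate a1 a2 b1 b2 c1 c2 aV bV V1 V2 e1 e2 d2| ≤ 14 * M ^ 2 * ν := by
  have hν : 0 ≤ ν := (abs_nonneg _).trans he1
  have u1 := abs_mul_le_of_abs_le hc1 he1
  have u2 := abs_mul_le_of_abs_le hc2 he2
  have u3 := abs_mul_le_of_abs_le ((abs_add_le _ _).trans
    (add_le_add (abs_mul_le_of_abs_le ha1 he1) (abs_mul_le_of_abs_le ha2 he2))) hV1
  have u4 := abs_mul_le_of_abs_le ((abs_add_le _ _).trans
    (add_le_add (abs_mul_le_of_abs_le hb1 he1) (abs_mul_le_of_abs_le hb2 he2))) hV2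
  have u5 := abs_mul_le_of_abs_le haV he1
  have u6 := abs_mul_le_of_abs_le hbV he2
  have u7 := abs_mul_le_of_abs_le ((abs_sub _ _).trans (add_le_add hb1 ha2))
    (abs_mul_le_of_abs_le he1 hd2)
  have hMν : M * ν ≤ M ^ 2 * ν := by gcongr; nlinarith
  rw [abs_le] at *
  unfold areaRate
  constructor <;> linarith [u1.1, u1.2, u2.1, u2.2, u3.1, u3.2, u4.1, u4.2, u5.1, u5.2, u6.1, u6.2,
    u7.1, u7.2]

section Curves

variable {A B C : ℝ → ℝ → ℝ → ℝ} {a1 a2 a3 b1 b2 b3 c0 c1 c2 c3 M ε τ V1 V2 : ℝ}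

lemma FirstOrderData.drift_le (h : FirstOrderData A B C a1 a2 a3 b1 b2 b3 c0 c1 c2 c3 M ε τ)
    (hV1 : |V1| ≤ M) (hV2 : |V2| ≤ M) :
    |a1 * V1 + a2 * V2 + a3 * c0| ≤ 3 * M ^ 2 ∧ |b1 * V1 + b2 * V2 + b3 * c0| ≤ 3 * M ^ 2 := by
  have key {k1 k2 k3 : ℝ} (h1 : |k1| ≤ M) (h2 : |k2| ≤ M) (h3 : |k3| ≤ M) :
      |k1 * V1 + k2 * V2 + k3 * c0| ≤ 3 * M ^ 2 := by
    have := abs_add_three (k1 * V1) (k2 * V2) (k3 * c0)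
    linarith [abs_mul_le_of_abs_le h1 hV1, abs_mul_le_of_abs_le h2 hV2,
      abs_mul_le_of_abs_le h3 h.c0_le]
  exact ⟨key h.a1_le h.a2_le h.a3_le, key h.b1_le h.b2_le h.b3_le⟩

/-- A contact curve whose planar projection stays close to a segment ends close to the endpoint of
the contact curve over that segment. -/
lemma FirstOrderData.abs_curve_endpoint_sub_le
    (h : FirstOrderData A B C a1 a2 a3 b1 b2 b3 c0 c1 c2 c3 M ε τ)
    (hV1 : |V1| ≤ M) (hV2 : |V2| ≤ M) {x y z x' y' : ℝ → ℝ} {L : NNReal} {ν : ℝ}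
    (hν : 14 * M ^ 2 * ν ≤ ε) (hνM : ν ≤ M)
    (hx : LipschitzOnWith L x (Icc 0 τ)) (hy : LipschitzOnWith L y (Icc 0 τ))
    (hz : LipschitzOnWith L z (Icc 0 τ)) (hLM : (L : ℝ) ≤ M)
    (hx0 : x 0 = 0) (hy0 : y 0 = 0) (hz0 : z 0 = 0)
    (hxτ : x τ = τ * V1) (hyτ : y τ = τ * V2)
    (hxν : ∀ t ∈ Icc 0 τ, |x t - t * V1| ≤ ν * τ) (hyν : ∀ t ∈ Icc 0 τ, |y t - t * V2| ≤ ν * τ)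
    (hd : ∀ᵐ t, t ∈ Icc 0 τ → HasDerivAt x (x' t) t ∧ HasDerivAt y (y' t) t ∧
      |x' t - V1| ≤ M ∧ |y' t - V2| ≤ M ∧
      HasDerivAt z (C (x t) (y t) (z t) + A (x t) (y t) (z t) * x' t
        + B (x t) (y t) (z t) * y' t) t) :
    |z τ - segmentEndpoint a1 a2 a3 b1 b2 b3 c0 c1 c2 c3 V1 V2 τ|
      ≤ expansionConst M * (ε * τ ^ 2) := by
  have hτ := h.pos
  have hid : AbsolutelyContinuousOnInterval (fun r : ℝ ↦ r) 0 1 :=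
    (LipschitzWith.id.lipschitzOnWith (s := uIcc (0 : ℝ) 1)).absolutelyContinuousOnInterval
  have hac0 : AbsolutelyContinuousOnInterval (fun _ : ℝ ↦ (0 : ℝ)) 0 1 := by
    simpa using hid.const_mul 0
  have hmem {r : ℝ} (hr : r ∈ Icc (0 : ℝ) 1) : τ * r ∈ Icc 0 τ :=
    ⟨by nlinarith [hr.1], by nlinarith [hr.2]⟩
  have hscale (V : ℝ) (f : ℝ → ℝ) (r : ℝ) :
      τ * (r * V + (τ⁻¹ * f (τ * r) - V * r)) = f (τ * r) := by
    field_simp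
    ring
  have hsmall {V : ℝ} {f : ℝ → ℝ} (hf : ∀ t ∈ Icc 0 τ, |f t - t * V| ≤ ν * τ) {r : ℝ}
      (hr : r ∈ Icc (0 : ℝ) 1) : |τ⁻¹ * f (τ * r) - V * r| ≤ ν := by
    have h1 := hf _ (hmem hr)
    rw [show τ⁻¹ * f (τ * r) - V * r = τ⁻¹ * (f (τ * r) - τ * r * V) by field_simp, abs_mul,
      abs_of_pos (inv_pos.2 hτ)]
    calc τ⁻¹ * |f (τ * r) - τ * r * V| ≤ τ⁻¹ * (ν * τ) := by gcongr
      _ = ν := by field_simp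
  have key := endpoint_expansion (A := A) (B := B) (C := C) (σ := 1)
    (e1 := fun r ↦ τ⁻¹ * x (τ * r) - V1 * r) (e2 := fun r ↦ τ⁻¹ * y (τ * r) - V2 * r)
    (d1 := fun r ↦ x' (τ * r) - V1) (d2 := fun r ↦ y' (τ * r) - V2)
    (z := fun r ↦ z (τ * r)) (G := fun _ ↦ 0) (G' := fun _ ↦ 0)
    h.one_le h.a1_le h.a2_le h.a3_le h.b1_le h.b2_le h.b3_le h.c0_le h.c1_le h.c2_le h.c3_le
    hV1 hV2 hτ h.le_acc h.acc_le (by simp; positivity) rfl rfl h.approxA h.approxB h.approxC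
    (((absolutelyContinuous_comp_mul_left hτ hx).const_mul _).sub (hid.const_mul _))
    (((absolutelyContinuous_comp_mul_left hτ hy).const_mul _).sub (hid.const_mul _))
    (absolutelyContinuous_comp_mul_left hτ hz) hac0
    (by simp [hx0]) (by simp [hy0]) (by simp [hxτ, hτ.ne']) (by simp [hyτ, hτ.ne'])
    (by simp [hz0]) rfl ?_ ?_
  · simpa only [mul_one, add_zero, segmentEndpoint, expansionConst] using key
  · intro r hr
    refine ⟨(hsmall hxν hr).trans hνM, (hsmall hyν hr).trans hνM, ?_⟩
    have h1 := hz.dist_le_mul _ (hmem hr) 0 ⟨le_rfl, hτ.le⟩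
    rw [hz0, Real.dist_eq, Real.dist_eq, sub_zero, sub_zero, abs_of_nonneg (hmem hr).1] at h1
    have h2 : (L : ℝ) * (τ * r) ≤ M * τ :=
      mul_le_mul hLM (hmem hr).2 (hmem hr).1 (by linarith [h.one_le])
    have h3 : 0 ≤ M * τ := mul_nonneg (by linarith [h.one_le]) hτ.le
    linarith
  · filter_upwards [ae_comp_mul_left hτ hd] with r hd hr
    obtain ⟨hdx, hdy, hx', hy', hdz⟩ := hd hr
    have hmul : HasDerivAt (fun r ↦ τ * r) (τ * 1) r := (hasDerivAt_id' r).const_mul τ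
    have hcomp {f : ℝ → ℝ} {f' V : ℝ} (hf : HasDerivAt f f' (τ * r)) :
        HasDerivAt (fun r ↦ τ⁻¹ * f (τ * r) - V * r) (f' - V) r := by
      refine (((hf.comp r hmul).const_mul τ⁻¹).sub ((hasDerivAt_id' r).const_mul V)).congr_deriv ?_
      field_simp
    refine ⟨hcomp hdx, hcomp hdy, hasDerivAt_const _ _, hx', hy', ?_, ?_⟩
    · rw [zero_sub, abs_neg]
      obtain ⟨haV, hbV⟩ := h.drift_le hV1 hV2
      exact (abs_areaRate_le h.one_le h.a1_le h.a2_le h.b1_le h.b2_le h.c1_le h.c2_le haV hbV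
        hV1 hV2 (hsmall hxν hr) (hsmall hyν hr) hy').trans hν
    · simp only [hscale]
      refine (hdz.comp r hmul).congr_deriv ?_
      ring

end Curves

/-- `A` is globally Lipschitz (for the `ℓ¹` distance) and bounded, both with constant `K`. -/
structure LipBdd (A : ℝ → ℝ → ℝ → ℝ) (K : ℝ) : Prop where
  lip : ∀ x y z x' y' z', |A x y z - A x' y' z'| ≤ K * (|x - x'| + |y - y'| + |z - z'|)
  bdd : ∀ x y z, |A x y z| ≤ K

lemma LipBdd.nonneg {A : ℝ → ℝ → ℝ → ℝ} {K : ℝ} (h : LipBdd A K) : 0 ≤ K :=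
  (abs_nonneg _).trans (h.bdd 0 0 0)

lemma LipBdd.continuous {A : ℝ → ℝ → ℝ → ℝ} {K : ℝ} (h : LipBdd A K) :
    Continuous fun p : ℝ × ℝ × ℝ ↦ A p.1 p.2.1 p.2.2 := by
  have : LipschitzWith (3 * K).toNNReal fun p : ℝ × ℝ × ℝ ↦ A p.1 p.2.1 p.2.2 := by
    refine LipschitzWith.of_dist_le_mul fun p p' ↦ ?_
    have hK := h.nonneg
    rw [Real.coe_toNNReal _ (by positivity), Real.dist_eq]
    refine (h.lip _ _ _ _ _ _).trans ?_
    have h1 : |p.1 - p'.1| ≤ dist p p' := by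
      rw [← Real.dist_eq]; exact le_max_left _ _
    have h2 : |p.2.1 - p'.2.1| ≤ dist p p' := by
      rw [← Real.dist_eq]; exact (le_max_left _ _).trans (le_max_right _ _)
    have h3 : |p.2.2 - p'.2.2| ≤ dist p p' := by
      rw [← Real.dist_eq]; exact (le_max_right _ _).trans (le_max_right _ _)
    nlinarith
  exact this.continuous

/-- First planar component of the basic loop; it has zero mean on `[0, 1]`. -/
def loopA (r : ℝ) : ℝ := r - 3 * r ^ 2 + 2 * r ^ 3

/-- The derivative of `loopA`. -/
def loopA' (r : ℝ) : ℝ := 1 - 6 * r + 6 * r ^ 2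

/-- Second planar component of the basic loop; it has zero mean on `[0, 1]`. -/
def loopB (r : ℝ) : ℝ := r - 6 * r ^ 2 + 10 * r ^ 3 - 5 * r ^ 4

/-- The derivative of `loopB`. -/
def loopB' (r : ℝ) : ℝ := 1 - 12 * r + 30 * r ^ 2 - 20 * r ^ 3

lemma hasDerivAt_loopA (r : ℝ) : HasDerivAt loopA (loopA' r) r := by
  have h := hasDerivAt_id' r
  refine ((h.sub ((h.pow 2).const_mul 3)).add ((h.pow 3).const_mul 2)).congr_deriv ?_
  simp [loopA']; ring

lemma hasDerivAt_loopB (r : ℝ) : HasDerivAt loopB (loopB' r) r := by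
  have h := hasDerivAt_id' r
  refine (((h.sub ((h.pow 2).const_mul 6)).add ((h.pow 3).const_mul 10)).sub
    ((h.pow 4).const_mul 5)).congr_deriv ?_
  simp [loopB']; ring

lemma continuous_loopA' : Continuous loopA' := by unfold loopA'; fun_prop

lemma continuous_loopB' : Continuous loopB' := by unfold loopB'; fun_prop

lemma abs_loop_le {r : ℝ} (hr : r ∈ Icc (0 : ℝ) 1) :
    |loopA r| ≤ 63 ∧ |loopA' r| ≤ 63 ∧ |loopB r| ≤ 63 ∧ |loopB' r| ≤ 63 := by
  have h0 := hr.1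
  have h1 := hr.2
  have p2 : 0 ≤ r ^ 2 ∧ r ^ 2 ≤ 1 := ⟨by positivity, pow_le_one₀ h0 h1⟩
  have p3 : 0 ≤ r ^ 3 ∧ r ^ 3 ≤ 1 := ⟨by positivity, pow_le_one₀ h0 h1⟩
  have p4 : 0 ≤ r ^ 4 ∧ r ^ 4 ≤ 1 := ⟨by positivity, pow_le_one₀ h0 h1⟩
  simp only [abs_le, loopA, loopA', loopB, loopB']
  refine ⟨⟨?_, ?_⟩, ⟨?_, ?_⟩, ⟨?_, ?_⟩, ⟨?_, ?_⟩⟩ <;> linarith [p2.1, p2.2, p3.1, p3.2, p4.1, p4.2]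

/-- The antiderivative of `k₁ loopA + k₂ loopB + k₃ loopA loopB'` vanishing at `0`. -/
def loopArea (k1 k2 k3 r : ℝ) : ℝ :=
  k1 * (r ^ 2 / 2 - r ^ 3 + r ^ 4 / 2) + k2 * (r ^ 2 / 2 - 2 * r ^ 3 + 5 / 2 * r ^ 4 - r ^ 5)
    + k3 * (r ^ 2 / 2 - 5 * r ^ 3 + 17 * r ^ 4 - 134 / 5 * r ^ 5 + 20 * r ^ 6 - 40 / 7 * r ^ 7)

lemma hasDerivAt_loopArea (k1 k2 k3 r : ℝ) : HasDerivAt (loopArea k1 k2 k3)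
    (k1 * loopA r + k2 * loopB r + k3 * (loopA r * loopB' r)) r := by
  have h := hasDerivAt_id' r
  refine ((((((h.pow 2).div_const 2).sub (h.pow 3)).add ((h.pow 4).div_const 2)).const_mul k1).add
    ((((((h.pow 2).div_const 2).sub ((h.pow 3).const_mul 2)).add
      ((h.pow 4).const_mul (5 / 2))).sub (h.pow 5)).const_mul k2)).add
    (((((((h.pow 2).div_const 2).sub ((h.pow 3).const_mul 5)).add ((h.pow 4).const_mul 17)).sub
      ((h.pow 5).const_mul (134 / 5))).add ((h.pow 6).const_mul 20)).sub
      ((h.pow 7).const_mul (40 / 7)) |>.const_mul k3) |>.congr_deriv ?_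
  simp [loopA, loopB, loopB']; ring

/-- The right-hand side of the contact equation over a segment perturbed by a loop. -/
def loopField (A B C : ℝ → ℝ → ℝ → ℝ) (V1 V2 τ σ δ r z θ : ℝ) : ℝ :=
  τ * σ * C (τ * (r * V1 + δ * loopA r)) (τ * (r * V2 + δ * θ * loopB r)) z
    + A (τ * (r * V1 + δ * loopA r)) (τ * (r * V2 + δ * θ * loopB r)) z
      * (τ * (V1 + δ * loopA' r))
    + B (τ * (r * V1 + δ * loopA r)) (τ * (r * V2 + δ * θ * loopB r)) z
      * (τ * (V2 + δ * θ * loopB' r))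

lemma abs_field_sub_le {s A A' B B' C C' D K S W v1 v2 v2' : ℝ} (hs : |s| ≤ 1)
    (hA : |A - A'| ≤ D) (hB : |B - B'| ≤ D) (hC : |C - C'| ≤ D) (hB' : |B'| ≤ K)
    (hv1 : |v1| ≤ S) (hv2 : |v2| ≤ S) (hv : |v2 - v2'| ≤ W) :
    |s * C + A * v1 + B * v2 - (s * C' + A' * v1 + B' * v2')| ≤ D + D * S + D * S + K * W := by
  rw [show s * C + A * v1 + B * v2 - (s * C' + A' * v1 + B' * v2')
    = s * (C - C') + (A - A') * v1 + (B - B') * v2 + B' * (v2 - v2') by ring]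
  have h1 := abs_mul_le_of_abs_le hs hC
  have h2 := abs_mul_le_of_abs_le hA hv1
  have h3 := abs_mul_le_of_abs_le hB hv2
  have h4 := abs_mul_le_of_abs_le hB' hv
  have h5 := abs_add_le (s * (C - C') + (A - A') * v1 + (B - B') * v2) (B' * (v2 - v2'))
  have h6 := abs_add_three (s * (C - C')) ((A - A') * v1) ((B - B') * v2)
  linarith

lemma abs_scaled_speed_le {τ V δ ϑ S p : ℝ} (hτ : 0 < τ) (hδ : 0 ≤ δ) (hδ1 : δ ≤ 1)
    (hϑ : |ϑ| ≤ 1) (hV : |V| ≤ S) (hp : |p| ≤ 63) : |τ * (V + δ * ϑ * p)| ≤ τ * (S + 63) := by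
  have h1 : |δ * ϑ * p| ≤ 1 * 1 * 63 :=
    abs_mul_le_of_abs_le (abs_mul_le_of_abs_le (by rwa [abs_of_nonneg hδ]) hϑ) hp
  rw [abs_mul, abs_of_pos hτ]
  exact mul_le_mul_of_nonneg_left ((abs_add_le _ _).trans (by linarith)) hτ.le

section LoopFamily

variable {A B C : ℝ → ℝ → ℝ → ℝ} {V1 V2 τ σ δ S K r θ θ' : ℝ}

lemma abs_loopField_le (hA : LipBdd A K) (hB : LipBdd B K) (hC : LipBdd C K)
    (hτ : 0 < τ) (hσ : |σ| ≤ 1) (hδ : 0 ≤ δ) (hδ1 : δ ≤ 1)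
    (hV1 : |V1| ≤ S) (hV2 : |V2| ≤ S) (hr : r ∈ Icc (0 : ℝ) 1) (hθ : |θ| ≤ 1) (z : ℝ) :
    |loopField A B C V1 V2 τ σ δ r z θ| ≤ K * (1 + 2 * (S + 63)) * τ := by
  obtain ⟨-, hA', -, hB'⟩ := abs_loop_le hr
  have v1 := abs_scaled_speed_le hτ hδ hδ1 (ϑ := 1) (by simp) hV1 hA'
  have v2 := abs_scaled_speed_le hτ hδ hδ1 hθ hV2 hB'
  rw [mul_one] at v1
  unfold loopField
  generalize τ * (r * V1 + δ * loopA r) = x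
  generalize τ * (r * V2 + δ * θ * loopB r) = y
  have h1 := abs_mul_le_of_abs_le (abs_mul_le_of_abs_le (abs_of_pos hτ).le hσ) (hC.bdd x y z)
  have h2 := abs_mul_le_of_abs_le (hA.bdd x y z) v1
  have h3 := abs_mul_le_of_abs_le (hB.bdd x y z) v2
  refine (abs_add_three _ _ _).trans ?_
  linarith

lemma abs_loopField_sub_le (hA : LipBdd A K) (hB : LipBdd B K) (hC : LipBdd C K)
    (hτ : 0 < τ) (hτ1 : τ ≤ 1) (hσ : |σ| ≤ 1) (hδ : 0 ≤ δ) (hδ1 : δ ≤ 1)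
    (hV1 : |V1| ≤ S) (hV2 : |V2| ≤ S) (hr : r ∈ Icc (0 : ℝ) 1) (hθ : |θ| ≤ 1) (z z' : ℝ) :
    |loopField A B C V1 V2 τ σ δ r z θ - loopField A B C V1 V2 τ σ δ r z' θ'|
      ≤ 63 * K * (2 + 2 * (S + 63)) * (|z - z'| + |θ - θ'|) := by
  obtain ⟨-, hA', hBl, hB'⟩ := abs_loop_le hr
  have hS : 0 ≤ S := (abs_nonneg _).trans hV1
  have hK := hA.nonneg
  have v1 := abs_scaled_speed_le hτ hδ hδ1 (ϑ := 1) (by simp) hV1 hA'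
  have v2 := abs_scaled_speed_le hτ hδ hδ1 hθ hV2 hB'
  rw [mul_one] at v1
  have hS' : τ * (S + 63) ≤ S + 63 := by nlinarith
  have hdiff {p : ℝ} (hp : |p| ≤ 63) :
      |τ * (r * V2 + δ * θ * p) - τ * (r * V2 + δ * θ' * p)| ≤ 63 * |θ - θ'| ∧
      |τ * (V2 + δ * θ * p) - τ * (V2 + δ * θ' * p)| ≤ 63 * |θ - θ'| := by
    have h1 : |τ * δ * (p * (θ - θ'))| ≤ 1 * 1 * (63 * |θ - θ'|) :=
      abs_mul_le_of_abs_le (abs_mul_le_of_abs_le (by rwa [abs_of_pos hτ])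
        (by rwa [abs_of_nonneg hδ])) (abs_mul_le_of_abs_le hp le_rfl)
    rw [one_mul, one_mul] at h1
    exact ⟨by convert h1 using 2; ring, by convert h1 using 2; ring⟩
  have hs : |τ * σ| ≤ 1 := by
    simpa using abs_mul_le_of_abs_le (show |τ| ≤ 1 by rwa [abs_of_pos hτ]) hσ
  have hD := (hdiff hBl).1
  have hW := (hdiff hB').2
  unfold loopField
  generalize τ * (r * V1 + δ * loopA r) = x
  generalize τ * (r * V2 + δ * θ * loopB r) = y at *
  generalize τ * (r * V2 + δ * θ' * loopB r) = y' at *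
  have hlip {E : ℝ → ℝ → ℝ → ℝ} (hE : LipBdd E K) :
      |E x y z - E x y' z'| ≤ K * (63 * |θ - θ'| + |z - z'|) := by
    refine (hE.lip _ _ _ _ _ _).trans ?_
    rw [sub_self, abs_zero, zero_add]
    gcongr
  refine (abs_field_sub_le hs (hlip hA) (hlip hB) (hlip hC) (hB.bdd _ _ _)
    (v1.trans hS') (v2.trans hS') hW).trans ?_
  have h1 : 0 ≤ K * |z - z'| := mul_nonneg hK (abs_nonneg _)
  have h2 : 0 ≤ K * S * |z - z'| := mul_nonneg (mul_nonneg hK hS) (abs_nonneg _)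
  linarith

lemma continuous_loopField (hA : LipBdd A K) (hB : LipBdd B K) (hC : LipBdd C K) (z θ : ℝ) :
    Continuous fun r ↦ loopField A B C V1 V2 τ σ δ r z θ := by
  have h1 : Continuous loopA := by unfold loopA; fun_prop
  have h2 : Continuous loopB := by unfold loopB; fun_prop
  have h3 := continuous_loopA'
  have h4 := continuous_loopB'
  have hp : Continuous fun r ↦
      (τ * (r * V1 + δ * loopA r), τ * (r * V2 + δ * θ * loopB r), z) := by fun_prop
  have hcA := hA.continuous.comp hp
  have hcB := hB.continuous.comp hp
  have hcC := hC.continuous.comp hp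
  simp only [Function.comp_def] at hcA hcB hcC
  exact ((continuous_const.mul hcC).add (hcA.mul (by fun_prop))).add (hcB.mul (by fun_prop))

variable {a1 a2 a3 b1 b2 b3 c0 c1 c2 c3 M ε : ℝ}

/-- Lifting a segment perturbed by a loop of signed size `θ` to contact curves gives a family whose
endpoints are, up to second order, affine in `θ` with slope proportional to `b1 - a2`. -/
lemma FirstOrderData.exists_loop_family
    (h : FirstOrderData A B C a1 a2 a3 b1 b2 b3 c0 c1 c2 c3 M ε τ)
    (hA : LipBdd A K) (hB : LipBdd B K) (hC : LipBdd C K)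
    (hσ1 : |σ| ≤ 1) (hσ : |σ - 1| ≤ τ ^ 2) (hδ : 0 ≤ δ) (hδ1 : δ ≤ 1)
    (hV1 : |V1| ≤ S) (hV2 : |V2| ≤ S) (hSM : S ≤ M) (hM : 63 ≤ M)
    (hKM : K * (1 + 2 * (S + 63)) ≤ M) :
    ∃ Z : ℝ → ℝ → ℝ, (∀ θ ∈ Icc (-1 : ℝ) 1, Z θ 0 = 0 ∧
      (∀ r ∈ Icc (0 : ℝ) 1,
        HasDerivWithinAt (Z θ) (loopField A B C V1 V2 τ σ δ r (Z θ r) θ) (Icc 0 1) r) ∧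
      (∀ r ∈ Icc (0 : ℝ) 1, |Z θ r| ≤ M * τ) ∧
      |Z θ 1 - (segmentEndpoint a1 a2 a3 b1 b2 b3 c0 c1 c2 c3 V1 V2 τ
        - τ ^ 2 * ((b1 - a2) * δ ^ 2 * θ / 70))| ≤ expansionConst M * (ε * τ ^ 2)) ∧
      ContinuousOn (fun θ ↦ Z θ 1) (Icc (-1) 1) := by
  have hτ := h.pos
  have hτ1 : τ ≤ 1 := h.le_acc.trans h.acc_le
  have hS : 0 ≤ S := (abs_nonneg _).trans hV1
  have hK := hA.nonneg
  have hM0 : 0 ≤ M := by linarith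
  have hV1M := hV1.trans hSM
  have hV2M := hV2.trans hSM
  obtain ⟨Z, hZ, hZc⟩ := exists_solution_family (F := loopField A B C V1 V2 τ σ δ)
    (K := 63 * K * (2 + 2 * (S + 63))) (L := M * τ) (by positivity) (by positivity)
    (fun r hr θ hθ θ' _ z z' ↦ abs_loopField_sub_le hA hB hC hτ hτ1 hσ1 hδ hδ1 hV1 hV2 hr
      (abs_le.2 hθ) z z')
    (fun θ _ z ↦ (continuous_loopField hA hB hC z θ).continuousOn)
    (fun r hr θ hθ z ↦ (abs_loopField_le hA hB hC hτ hσ1 hδ hδ1 hV1 hV2 hr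
      (abs_le.2 hθ) z).trans (mul_le_mul_of_nonneg_right hKM hτ.le))
  refine ⟨Z, fun θ hθ ↦ ⟨(hZ θ hθ).1, (hZ θ hθ).2, ?_⟩, hZc⟩
  obtain ⟨hZ0, hZd⟩ := hZ θ hθ
  have hθ' : |θ| ≤ 1 := abs_le.2 hθ
  have hbd (r) (hr : r ∈ Icc (0 : ℝ) 1) :
      ‖loopField A B C V1 V2 τ σ δ r (Z θ r) θ‖ ≤ M * τ :=
    (abs_loopField_le hA hB hC hτ hσ1 hδ hδ1 hV1 hV2 hr hθ' _).trans
      (mul_le_mul_of_nonneg_right hKM hτ.le)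
  have hZb (r) (hr : r ∈ Icc (0 : ℝ) 1) : |Z θ r| ≤ M * τ := by
    have h1 := Convex.norm_image_sub_le_of_norm_hasDerivWithin_le hZd hbd (convex_Icc _ _)
      (left_mem_Icc.2 zero_le_one) hr
    rw [hZ0, sub_zero, sub_zero, Real.norm_eq_abs, Real.norm_eq_abs, abs_of_nonneg hr.1] at h1
    exact h1.trans (mul_le_of_le_one_right (by positivity) hr.2)
  have hZac : AbsolutelyContinuousOnInterval (Z θ) 0 1 := by
    have := Convex.lipschitzOnWith_of_nnnorm_hasDerivWithin_le (C := (M * τ).toNNReal)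
      (convex_Icc 0 1) hZd fun r hr ↦ by
        rw [← NNReal.coe_le_coe, coe_nnnorm, Real.coe_toNNReal _ (by positivity)]
        exact hbd r hr
    rw [← uIcc_of_le zero_le_one] at this
    exact this.absolutelyContinuousOnInterval
  have hacP {f : ℝ → ℝ} (hf : ContDiff ℝ 1 f) : AbsolutelyContinuousOnInterval f 0 1 :=
    hf.contDiffOn.absolutelyContinuousOnInterval
  have hsmall {ϑ p : ℝ} (hϑ : |ϑ| ≤ 1) (hp : |p| ≤ 63) : |δ * ϑ * p| ≤ M := by
    have h1 : |δ * ϑ * p| ≤ 1 * 1 * 63 :=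
      abs_mul_le_of_abs_le (abs_mul_le_of_abs_le (by rwa [abs_of_nonneg hδ]) hϑ) hp
    linarith
  have hsmall1 {p : ℝ} (hp : |p| ≤ 63) : |δ * p| ≤ M := by
    simpa using hsmall (ϑ := 1) (by simp) hp
  refine ⟨hZb, ?_⟩
  have key := endpoint_expansion (A := A) (B := B) (C := C) (σ := σ)
    (e1 := fun r ↦ δ * loopA r) (e2 := fun r ↦ δ * θ * loopB r)
    (d1 := fun r ↦ δ * loopA' r) (d2 := fun r ↦ δ * θ * loopB' r)
    (z := Z θ) (G := loopArea
      (δ * (c1 + a1 * V1 + b1 * V2 - (a1 * V1 + a2 * V2 + a3 * c0)))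
      (δ * θ * (c2 + a2 * V1 + b2 * V2 - (b1 * V1 + b2 * V2 + b3 * c0)))
      ((b1 - a2) * δ ^ 2 * θ))
    (G' := fun r ↦ δ * (c1 + a1 * V1 + b1 * V2 - (a1 * V1 + a2 * V2 + a3 * c0)) * loopA r
      + δ * θ * (c2 + a2 * V1 + b2 * V2 - (b1 * V1 + b2 * V2 + b3 * c0)) * loopB r
      + (b1 - a2) * δ ^ 2 * θ * (loopA r * loopB' r))
    h.one_le h.a1_le h.a2_le h.a3_le h.b1_le h.b2_le h.b3_le h.c0_le h.c1_le h.c2_le h.c3_le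
    hV1M hV2M hτ h.le_acc h.acc_le hσ rfl rfl h.approxA h.approxB h.approxC
    (hacP (by unfold loopA; fun_prop)) (hacP (by unfold loopB; fun_prop)) hZac
    (hacP (by unfold loopArea; fun_prop))
    (by simp [loopA]) (by simp [loopB]) (by simp [loopA]; norm_num) (by simp [loopB]; norm_num)
    hZ0 (by simp [loopArea]) ?_ ?_
  · rw [expansionConst]
    convert key using 2
    simp only [loopArea, segmentEndpoint]
    ring
  · intro r hr
    obtain ⟨hp1, -, hp2, -⟩ := abs_loop_le hr
    refine ⟨hsmall1 hp1, hsmall hθ' hp2, (hZb r hr).trans ?_⟩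
    have : 0 ≤ M * τ := by positivity
    linarith
  · have hne (a : ℝ) : ∀ᵐ r : ℝ, r ≠ a := by simp [ae_iff]
    filter_upwards [hne 0, hne 1] with r hr0 hr1 hr
    obtain ⟨-, hp1, -, hp2⟩ := abs_loop_le hr
    refine ⟨(hasDerivAt_loopA r).const_mul _, (hasDerivAt_loopB r).const_mul _,
      hasDerivAt_loopArea _ _ _ r, hsmall1 hp1, hsmall hθ' hp2, ?_, ?_⟩
    · have hε : 0 ≤ ε := hτ.le.trans h.le_acc
      convert hε using 1
      rw [abs_eq_zero, areaRate]
      ring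
    · exact (hZd r hr).hasDerivAt
        (Icc_mem_nhds (lt_of_le_of_ne hr.1 hr0.symm) (lt_of_le_of_ne hr.2 hr1))

end LoopFamily

/-- `A` has the first-order expansion `a0 + a1 x + a2 y + a3 z` at the origin of `ℝ³`. -/
def FirstOrder (A : ℝ → ℝ → ℝ → ℝ) (a0 a1 a2 a3 : ℝ) : Prop :=
  ∀ ε > 0, ∃ ρ > 0, ∀ s, 0 < s → s ≤ ρ → ∀ x y w, |x| ≤ s → |y| ≤ s → |w| ≤ s →
    |A x y w - (a0 + a1 * x + a2 * y + a3 * w)| ≤ ε * s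

lemma FirstOrder.eventually {A : ℝ → ℝ → ℝ → ℝ} {a0 a1 a2 a3 : ℝ}
    (h : FirstOrder A a0 a1 a2 a3) {M ε : ℝ} (hM : 0 < M) (hε : 0 < ε) :
    ∀ᶠ τ in nhdsWithin (0 : ℝ) (Ioi 0), ∀ x y w, |x| ≤ 2 * M * τ → |y| ≤ 2 * M * τ →
      |w| ≤ 2 * M * τ → |A x y w - (a0 + a1 * x + a2 * y + a3 * w)| ≤ ε * τ := by
  obtain ⟨ρ, hρ, h⟩ := h (ε / (2 * M)) (by positivity)
  filter_upwards [Ioc_mem_nhdsGT (show 0 < ρ / (2 * M) by positivity)] with τ hτ x y w hx hy hw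
  have h1 : 2 * M * τ ≤ ρ := by
    have := (le_div_iff₀ (by positivity)).1 hτ.2
    linarith
  refine (h _ (by have := hτ.1; positivity) h1 x y w hx hy hw).trans (le_of_eq ?_)
  field_simp

section Shortcut

variable {A B C : ℝ → ℝ → ℝ → ℝ} {V1 V2 τ σ δ S K : ℝ}
variable {a1 a2 a3 b1 b2 b3 c0 c1 c2 c3 M ε : ℝ}

lemma FirstOrderData.exists_loop_through
    (h : FirstOrderData A B C a1 a2 a3 b1 b2 b3 c0 c1 c2 c3 M ε τ)
    (hA : LipBdd A K) (hB : LipBdd B K) (hC : LipBdd C K)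
    (hσ1 : |σ| ≤ 1) (hσ : |σ - 1| ≤ τ ^ 2) (hδ : 0 ≤ δ) (hδ1 : δ ≤ 1)
    (hV1 : |V1| ≤ S) (hV2 : |V2| ≤ S) (hSM : S ≤ M) (hM : 63 ≤ M)
    (hKM : K * (1 + 2 * (S + 63)) ≤ M)
    (hε : 2 * (expansionConst M * ε) < |(b1 - a2) * δ ^ 2 / 70|) {zf : ℝ}
    (hzf : |zf - segmentEndpoint a1 a2 a3 b1 b2 b3 c0 c1 c2 c3 V1 V2 τ|
      ≤ expansionConst M * (ε * τ ^ 2)) :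
    ∃ θ ∈ Icc (-1 : ℝ) 1, ∃ Z : ℝ → ℝ, Z 0 = 0 ∧ Z 1 = zf ∧
      (∀ r ∈ Icc (0 : ℝ) 1,
        HasDerivWithinAt Z (loopField A B C V1 V2 τ σ δ r (Z r) θ) (Icc 0 1) r) ∧
      ∀ r ∈ Icc (0 : ℝ) 1, |Z r| ≤ M * τ := by
  obtain ⟨Z, hZ, hZc⟩ := h.exists_loop_family hA hB hC hσ1 hσ hδ hδ1 hV1 hV2 hSM hM hKM
  rw [← uIcc_of_le (by norm_num : (-1 : ℝ) ≤ 1)] at hZc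
  have hmem : zf ∈ uIcc (Z (-1) 1) (Z 1 1) := by
    have h1 := (hZ 1 (by norm_num)).2.2.2
    have h2 := (hZ (-1) (by norm_num)).2.2.2
    generalize segmentEndpoint a1 a2 a3 b1 b2 b3 c0 c1 c2 c3 V1 V2 τ = s at *
    have h3 : τ ^ 2 * (2 * (expansionConst M * ε)) < τ ^ 2 * |(b1 - a2) * δ ^ 2 / 70| :=
      mul_lt_mul_of_pos_left hε (pow_pos h.pos 2)
    rw [mem_uIcc]
    rw [abs_le] at *
    rcases abs_cases ((b1 - a2) * δ ^ 2 / 70) with ⟨h4, -⟩ | ⟨h4, -⟩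
    · rw [h4] at h3
      right
      constructor <;> linarith [h1.1, h1.2, h2.1, h2.2]
    · rw [h4] at h3
      left
      constructor <;> linarith [h1.1, h1.2, h2.1, h2.2]
  obtain ⟨θ, hθ, hθz⟩ := intermediate_value_uIcc hZc hmem
  rw [uIcc_of_le (by norm_num)] at hθ
  exact ⟨θ, hθ, Z θ, (hZ θ hθ).1, hθz, (hZ θ hθ).2.1, (hZ θ hθ).2.2.1⟩

/-- Slowed-down bounds for the planar speed of a perturbed segment. -/
lemma abs_slowed_speed_sub_le {η p V xb : ℝ} (hτ : 0 < τ) (hτ2 : τ ≤ 1 / 2)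
    (hp : |p| ≤ 63) (hδ : 0 ≤ δ) (hδη : δ ≤ η / 200) (hδ1 : δ ≤ 1)
    (hV : |V| ≤ S) (hVx : |V - xb| ≤ η / 4) (hS : (S + 63) * τ ≤ η / 8) {ϑ : ℝ} (hϑ : |ϑ| ≤ 1) :
    |τ * (V + δ * ϑ * p) / ((1 - τ ^ 2) * τ) - xb| ≤ η := by
  have hσ : 0 < 1 - τ ^ 2 := by nlinarith
  have e : τ * (V + δ * ϑ * p) / ((1 - τ ^ 2) * τ) - xb
      = (V - xb) + δ * (ϑ * p) + τ ^ 2 / (1 - τ ^ 2) * (V + δ * ϑ * p) := by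
    field_simp
    ring
  have h0 : |ϑ * p| ≤ 1 * 63 := abs_mul_le_of_abs_le hϑ hp
  have h1 : |δ * (ϑ * p)| ≤ η / 200 * (1 * 63) :=
    abs_mul_le_of_abs_le (by rwa [abs_of_nonneg hδ]) h0
  have h2 : |V + δ * ϑ * p| ≤ S + 63 := by
    have : |δ * ϑ * p| ≤ 1 * 1 * 63 :=
      abs_mul_le_of_abs_le (abs_mul_le_of_abs_le (by rwa [abs_of_nonneg hδ]) hϑ) hp
    exact (abs_add_le _ _).trans (by linarith)
  have h3 : |τ ^ 2 / (1 - τ ^ 2)| ≤ 2 * τ := by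
    rw [abs_of_nonneg (by positivity), div_le_iff₀ hσ]
    nlinarith
  have h4 := abs_mul_le_of_abs_le h3 h2
  have hη : 0 ≤ η := by linarith
  rw [e]
  refine (abs_add_three _ _ _).trans ?_
  linarith

/-- A contact curve over a perturbed segment on `[0, 1]`, run on `[0, (1 - τ ^ 2) * τ]`. -/
lemma exists_slowed_loop_curve {η xb yb θ : ℝ} {Z : ℝ → ℝ} (hτ : 0 < τ) (hτ2 : τ ≤ 1 / 2)
    (hδ : 0 ≤ δ) (hδη : δ ≤ η / 200) (hδ1 : δ ≤ 1) (hθ : |θ| ≤ 1)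
    (hV1 : |V1| ≤ S) (hV2 : |V2| ≤ S) (hVx : |V1 - xb| ≤ η / 4) (hVy : |V2 - yb| ≤ η / 4)
    (hS : (S + 63) * τ ≤ η / 8) (hZ0 : Z 0 = 0)
    (hZd : ∀ r ∈ Icc (0 : ℝ) 1,
      HasDerivWithinAt Z (loopField A B C V1 V2 τ (1 - τ ^ 2) δ r (Z r) θ) (Icc 0 1) r)
    (hZb : ∀ r ∈ Icc (0 : ℝ) 1, |Z r| ≤ η) :
    ∃ s ∈ Ioo 0 τ, ∃ X Y W X' Y' : ℝ → ℝ,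
      X 0 = 0 ∧ Y 0 = 0 ∧ W 0 = 0 ∧ X s = τ * V1 ∧ Y s = τ * V2 ∧ W s = Z 1 ∧
      Continuous X' ∧ Continuous Y' ∧
      ∀ t ∈ Icc 0 s, |X t| ≤ η ∧ |Y t| ≤ η ∧ |W t| ≤ η ∧ |X' t - xb| ≤ η ∧ |Y' t - yb| ≤ η ∧
        HasDerivWithinAt X (X' t) (Icc 0 s) t ∧ HasDerivWithinAt Y (Y' t) (Icc 0 s) t ∧
        HasDerivWithinAt W (C (X t) (Y t) (W t) + A (X t) (Y t) (W t) * X' t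
          + B (X t) (Y t) (W t) * Y' t) (Icc 0 s) t := by
  have hσ0 : 0 < 1 - τ ^ 2 := by nlinarith
  obtain ⟨s, hs⟩ : ∃ s, s = (1 - τ ^ 2) * τ := ⟨_, rfl⟩
  have hs0 : 0 < s := by rw [hs]; positivity
  have hsτ : s < τ := by
    have := pow_pos hτ 3
    rw [hs]
    linarith
  refine ⟨s, ⟨hs0, hsτ⟩,
    fun t ↦ τ * (t / s * V1 + δ * loopA (t / s)),
    fun t ↦ τ * (t / s * V2 + δ * θ * loopB (t / s)), fun t ↦ Z (t / s),
    fun t ↦ τ * (V1 + δ * loopA' (t / s)) / s,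
    fun t ↦ τ * (V2 + δ * θ * loopB' (t / s)) / s,
    by simp [loopA], by simp [loopB], by simpa using hZ0, ?_, ?_, ?_, ?_, ?_, ?_⟩
  · simp only [div_self hs0.ne', loopA]
    ring
  · simp only [div_self hs0.ne', loopB]
    ring
  · simp only [div_self hs0.ne']
  · have := continuous_loopA'
    fun_prop
  · have := continuous_loopB'
    fun_prop
  intro t ht
  have hr : t / s ∈ Icc (0 : ℝ) 1 := ⟨div_nonneg ht.1 hs0.le, (div_le_one₀ hs0).2 ht.2⟩
  obtain ⟨q1, q2, q3, q4⟩ := abs_loop_le hr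
  have hη : 0 ≤ η := (abs_nonneg _).trans (hZb _ hr)
  have hpos {V ϑ p : ℝ} (hV : |V| ≤ S) (hϑ : |ϑ| ≤ 1) (hp : |p| ≤ 63) :
      |τ * (t / s * V + δ * ϑ * p)| ≤ η := by
    have h1 : |t / s * V| ≤ 1 * S :=
      abs_mul_le_of_abs_le (by rw [abs_of_nonneg hr.1]; exact hr.2) hV
    rw [one_mul] at h1
    have h2 := abs_scaled_speed_le hτ hδ hδ1 hϑ h1 hp
    linarith
  have hdr : HasDerivAt (fun t ↦ t / s) (1 / s) t := (hasDerivAt_id' t).div_const s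
  refine ⟨?_, hpos hV2 hθ q3, hZb _ hr, ?_, ?_, ?_, ?_, ?_⟩
  · simpa using hpos hV1 (ϑ := 1) (by simp) q1
  · have := abs_slowed_speed_sub_le hτ hτ2 q2 hδ hδη hδ1 hV1 hVx hS (ϑ := 1) (by simp)
    rw [← hs] at this
    simpa only [mul_one] using this
  · have := abs_slowed_speed_sub_le hτ hτ2 q4 hδ hδη hδ1 hV2 hVy hS hθ
    rwa [← hs] at this
  · refine ((hdr.mul_const V1).add
      (((hasDerivAt_loopA _).comp t hdr).const_mul δ)).const_mul τ |>.congr_deriv ?_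
      |>.hasDerivWithinAt
    ring
  · refine ((hdr.mul_const V2).add
      (((hasDerivAt_loopB _).comp t hdr).const_mul (δ * θ))).const_mul τ |>.congr_deriv ?_
      |>.hasDerivWithinAt
    ring
  · have hmaps : MapsTo (fun t ↦ t / s) (Icc 0 s) (Icc 0 1) := fun t ht ↦
      ⟨div_nonneg ht.1 hs0.le, (div_le_one₀ hs0).2 ht.2⟩
    refine ((hZd _ hr).comp t hdr.hasDerivWithinAt hmaps).congr_deriv ?_
    have h1 : τ * (1 - τ ^ 2) = s := by rw [hs]; ring
    rw [loopField, h1]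
    have h2 : s * (1 / s) = 1 := mul_one_div_cancel hs0.ne'
    rw [add_mul, add_mul, mul_right_comm, h2]
    ring

/-- Over a planar contact structure with nonzero curvature `b1 - a2`, a contact curve that is
differentiable at its initial point can be replaced by a strictly faster one with the same endpoints
and with nearly the same planar velocity. -/
lemma exists_faster_contact_curve (hA : LipBdd A K) (hB : LipBdd B K) (hC : LipBdd C K)
    (hfA : FirstOrder A 0 a1 a2 a3) (hfB : FirstOrder B 0 b1 b2 b3)
    (hfC : FirstOrder C c0 c1 c2 c3) (hκ : b1 - a2 ≠ 0)
    {x y z x' y' : ℝ → ℝ} {xb yb T η : ℝ} {L : NNReal} (hT : 0 < T)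
    (hx : LipschitzOnWith L x (Icc 0 T)) (hy : LipschitzOnWith L y (Icc 0 T))
    (hz : LipschitzOnWith L z (Icc 0 T)) (hx0 : x 0 = 0) (hy0 : y 0 = 0) (hz0 : z 0 = 0)
    (hxb : HasDerivWithinAt x xb (Ici 0) 0) (hyb : HasDerivWithinAt y yb (Ici 0) 0)
    (hd : ∀ᵐ t, t ∈ Icc 0 T → HasDerivAt x (x' t) t ∧ HasDerivAt y (y' t) t ∧
      HasDerivAt z (C (x t) (y t) (z t) + A (x t) (y t) (z t) * x' t
        + B (x t) (y t) (z t) * y' t) t) (hη : 0 < η) :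
    ∃ τ ∈ Ioc 0 T, ∃ s ∈ Ioo 0 τ, ∃ X Y Z X' Y' : ℝ → ℝ,
      X 0 = 0 ∧ Y 0 = 0 ∧ Z 0 = 0 ∧ X s = x τ ∧ Y s = y τ ∧ Z s = z τ ∧
      Continuous X' ∧ Continuous Y' ∧
      ∀ t ∈ Icc 0 s, |X t| ≤ η ∧ |Y t| ≤ η ∧ |Z t| ≤ η ∧ |X' t - xb| ≤ η ∧ |Y' t - yb| ≤ η ∧
        HasDerivWithinAt X (X' t) (Icc 0 s) t ∧ HasDerivWithinAt Y (Y' t) (Icc 0 s) t ∧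
        HasDerivWithinAt Z (C (X t) (Y t) (Z t) + A (X t) (Y t) (Z t) * X' t
          + B (X t) (Y t) (Z t) * Y' t) (Icc 0 s) t := by
  have hK := hA.nonneg
  obtain ⟨M, hM⟩ : ∃ M : ℝ, M = 63 + 2 * L + K * (1 + 2 * (L + 63)) + |a1| + |a2| + |a3| + |b1|
    + |b2| + |b3| + |c0| + |c1| + |c2| + |c3| := ⟨_, rfl⟩
  have hL : (0 : ℝ) ≤ L := L.2
  have hKL : 0 ≤ K * (1 + 2 * ((L : ℝ) + 63)) := by positivity
  have p1 := abs_nonneg a1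
  have p2 := abs_nonneg a2
  have p3 := abs_nonneg a3
  have p4 := abs_nonneg b1
  have p5 := abs_nonneg b2
  have p6 := abs_nonneg b3
  have p7 := abs_nonneg c0
  have p8 := abs_nonneg c1
  have p9 := abs_nonneg c2
  have p10 := abs_nonneg c3
  have hM63 : 63 + 2 * (L : ℝ) ≤ M := by linarith
  have hM0 : 0 < M := by linarith
  have hP : 0 < expansionConst M := by unfold expansionConst; positivity
  obtain ⟨δ, hδ, hδ1, hδη⟩ : ∃ δ : ℝ, 0 < δ ∧ δ ≤ 1 ∧ δ ≤ η / 200 :=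
    ⟨min 1 (η / 200), by positivity, min_le_left _ _, min_le_right _ _⟩
  have hκδ : 0 < |(b1 - a2) * δ ^ 2 / 70| :=
    abs_pos.2 (div_ne_zero (mul_ne_zero hκ (pow_pos hδ 2).ne') (by norm_num))
  obtain ⟨ε, hε, hε1, hεκ⟩ : ∃ ε : ℝ, 0 < ε ∧ ε ≤ 1 ∧
      2 * (expansionConst M * ε) < |(b1 - a2) * δ ^ 2 / 70| := by
    refine ⟨min 1 (|(b1 - a2) * δ ^ 2 / 70| / (4 * expansionConst M)), by positivity,
      min_le_left _ _, ?_⟩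
    have h1 := min_le_right 1 (|(b1 - a2) * δ ^ 2 / 70| / (4 * expansionConst M))
    rw [le_div_iff₀ (by positivity)] at h1
    linarith
  obtain ⟨ν, hν, hνε, hνM⟩ : ∃ ν : ℝ, 0 < ν ∧ 14 * M ^ 2 * ν ≤ ε ∧ ν ≤ M := by
    refine ⟨ε / (14 * M ^ 2), by positivity, le_of_eq (by field_simp), ?_⟩
    rw [div_le_iff₀ (by positivity)]
    have : 1 ≤ M ^ 3 := one_le_pow₀ (by linarith)
    linarith
  obtain ⟨η₁, hη₁, hη₁ν, hη₁η⟩ : ∃ η₁ : ℝ, 0 < η₁ ∧ η₁ ≤ ν / 2 ∧ η₁ ≤ η / 4 :=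
    ⟨min (ν / 2) (η / 4), by positivity, min_le_left _ _, min_le_right _ _⟩
  have hclose {f : ℝ → ℝ} {fb : ℝ} (hf : HasDerivWithinAt f fb (Ici 0) 0) (hf0 : f 0 = 0) :
      ∀ᶠ τ in nhdsWithin (0 : ℝ) (Ioi 0), ∀ t ∈ Icc 0 τ, |f t - t * fb| ≤ η₁ * t := by
    have h1 := hf.isLittleO.def hη₁
    obtain ⟨R, hR, hR'⟩ := (mem_nhdsGE_iff_exists_Icc_subset (a := (0 : ℝ))).1 h1
    filter_upwards [Ioc_mem_nhdsGT hR] with τ hτ t ht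
    have h2 : ‖f t - f 0 - (t - 0) • fb‖ ≤ η₁ * ‖t - 0‖ := hR' ⟨ht.1, ht.2.trans hτ.2⟩
    simpa [hf0, abs_of_nonneg ht.1] using h2
  have hIoc {R : ℝ} (hR : 0 < R) : ∀ᶠ τ in nhdsWithin (0 : ℝ) (Ioi 0), τ ∈ Ioc 0 R :=
    Ioc_mem_nhdsGT hR
  obtain ⟨τ, hτx, hτy, hτA, hτB, hτC, hτ, hτT, hτε, hτ2, hτη⟩ :=
    ((hclose hxb hx0).and ((hclose hyb hy0).and ((hfA.eventually hM0 hε).and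
      ((hfB.eventually hM0 hε).and ((hfC.eventually hM0 hε).and
      ((eventually_mem_nhdsWithin (a := (0 : ℝ)) (s := Ioi 0)).and
      ((hIoc hT).and ((hIoc hε).and ((hIoc (by norm_num : (0 : ℝ) < 1 / 2)).and
      (hIoc (show 0 < η / (8 * M) by positivity))))))))))).exists
  replace hτ : 0 < τ := hτ
  replace hτη : M * τ ≤ η / 8 := by
    have := (le_div_iff₀ (by positivity)).1 hτη.2
    linarith
  replace hτ2 := hτ2.2
  have hdata : FirstOrderData A B C a1 a2 a3 b1 b2 b3 c0 c1 c2 c3 M ε τ := by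
    constructor <;> first | linarith | skip
    · exact hτε.2
    · simpa only [zero_add] using hτA
    · simpa only [zero_add] using hτB
    · exact hτC
  have hττ : τ ∈ Icc 0 τ := ⟨hτ.le, le_rfl⟩
  have hsub : Icc 0 τ ⊆ Icc 0 T := Icc_subset_Icc_right hτT.2
  have hVL {f : ℝ → ℝ} (hf : LipschitzOnWith L f (Icc 0 T)) (hf0 : f 0 = 0) :
      |f τ / τ| ≤ L := by
    have h1 := hf.dist_le_mul τ ⟨hτ.le, hτT.2⟩ 0 ⟨le_rfl, hT.le⟩
    rw [hf0, Real.dist_eq, Real.dist_eq, sub_zero, sub_zero, abs_of_pos hτ] at h1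
    rwa [abs_div, abs_of_pos hτ, div_le_iff₀ hτ]
  have hVb {f : ℝ → ℝ} {fb : ℝ} (hf : ∀ t ∈ Icc 0 τ, |f t - t * fb| ≤ η₁ * t) :
      |f τ / τ - fb| ≤ η₁ := by
    have h1 := hf τ hττ
    rw [show f τ / τ - fb = (f τ - τ * fb) / τ by field_simp, abs_div, abs_of_pos hτ,
      div_le_iff₀ hτ]
    exact h1
  have hVν {f : ℝ → ℝ} {fb : ℝ} (hf : ∀ t ∈ Icc 0 τ, |f t - t * fb| ≤ η₁ * t) :
      ∀ t ∈ Icc 0 τ, |f t - t * (f τ / τ)| ≤ ν * τ := by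
    intro t ht
    have h1 := hf t ht
    have h2 : |t * (f τ / τ - fb)| ≤ τ * η₁ :=
      abs_mul_le_of_abs_le (by rw [abs_of_nonneg ht.1]; exact ht.2) (hVb hf)
    rw [show f t - t * (f τ / τ) = (f t - t * fb) - t * (f τ / τ - fb) by ring]
    refine (abs_sub _ _).trans ?_
    have h3 : η₁ * t ≤ η₁ * τ := mul_le_mul_of_nonneg_left ht.2 hη₁.le
    have h4 : η₁ * τ ≤ ν / 2 * τ := mul_le_mul_of_nonneg_right hη₁ν hτ.le
    linarith
  have hne (a : ℝ) : ∀ᵐ r : ℝ, r ≠ a := by simp [ae_iff]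
  have hzτ := hdata.abs_curve_endpoint_sub_le (V1 := x τ / τ) (V2 := y τ / τ)
    ((hVL hx hx0).trans (by linarith)) ((hVL hy hy0).trans (by linarith)) (x' := x') (y' := y')
    hνε hνM (hx.mono hsub) (hy.mono hsub) (hz.mono hsub) (by linarith) hx0 hy0 hz0
    (by field_simp) (by field_simp) (hVν hτx) (hVν hτy) (by
      filter_upwards [hd, hne 0, hne T] with t ht ht0 htT htI
      obtain ⟨h1, h2, h3⟩ := ht (hsub htI)
      have hnhds : Icc 0 T ∈ nhds t := Icc_mem_nhds (lt_of_le_of_ne htI.1 ht0.symm)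
        (lt_of_le_of_ne (hsub htI).2 htT)
      have b1 := h1.le_of_lipschitzOn hnhds hx
      have b2 := h2.le_of_lipschitzOn hnhds hy
      rw [Real.norm_eq_abs] at b1 b2
      refine ⟨h1, h2, (abs_sub _ _).trans ?_, (abs_sub _ _).trans ?_, h3⟩
      · linarith [hVL hx hx0]
      · linarith [hVL hy hy0])
  have hτsq : 0 < τ ^ 2 := by positivity
  have hσ0 : 0 < 1 - τ ^ 2 := by nlinarith
  obtain ⟨θ, hθ, Z, hZ0, hZ1, hZd, hZb⟩ := hdata.exists_loop_through (S := L) (σ := 1 - τ ^ 2)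
    (δ := δ) hA hB hC (abs_le.2 ⟨by linarith, by linarith⟩) (by simp) hδ.le hδ1 (hVL hx hx0)
    (hVL hy hy0) (by linarith) (by linarith) (by linarith) hεκ hzτ
  have hLτ : ((L : ℝ) + 63) * τ ≤ η / 8 :=
    (mul_le_mul_of_nonneg_right (by linarith) hτ.le).trans hτη
  obtain ⟨s, hs, X, Y, W, X', Y', hX0, hY0, hW0, hXs, hYs, hWs, h⟩ :=
    exists_slowed_loop_curve hτ hτ2 hδ.le hδη hδ1 (abs_le.2 hθ) (hVL hx hx0) (hVL hy hy0)
      ((hVb hτx).trans hη₁η) ((hVb hτy).trans hη₁η) hLτ hZ0 hZd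
      fun r hr ↦ (hZb r hr).trans (by linarith)
  exact ⟨τ, hτT, s, hs, X, Y, W, X', Y', hX0, hY0, hW0, hXs.trans (mul_div_cancel₀ _ hτ.ne'),
    hYs.trans (mul_div_cancel₀ _ hτ.ne'), hWs.trans hZ1, h⟩

end Shortcut

lemma LipBdd.mono {A : ℝ → ℝ → ℝ → ℝ} {K K' : ℝ} (h : LipBdd A K) (hK : K ≤ K') : LipBdd A K' :=
  ⟨fun x y z x' y' z' ↦ (h.lip _ _ _ _ _ _).trans (by gcongr), fun x y z ↦ (h.bdd _ _ _).trans hK⟩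

/-- The retraction of the line onto `[-ρ, ρ]`. -/
def clamp (ρ x : ℝ) : ℝ := max (min x ρ) (-ρ)

lemma abs_clamp_sub_le (ρ x y : ℝ) : |clamp ρ x - clamp ρ y| ≤ |x - y| :=
  (abs_max_sub_max_le_abs _ _ _).trans
    ((abs_min_sub_min_le_max _ _ _ _).trans (by simp))

lemma clamp_of_abs_le {ρ x : ℝ} (h : |x| ≤ ρ) : clamp ρ x = x := by
  rw [abs_le] at h
  rw [clamp, min_eq_left h.2, max_eq_left h.1]

lemma abs_clamp_le {ρ : ℝ} (hρ : 0 ≤ ρ) (x : ℝ) : |clamp ρ x| ≤ ρ :=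
  abs_le.2 ⟨le_max_right _ _, max_le (min_le_right _ _) (by linarith)⟩

lemma norm_triple_le {ρ x y z : ℝ} (hx : |x| ≤ ρ) (hy : |y| ≤ ρ) (hz : |z| ≤ ρ) :
    ‖(x, y, z)‖ ≤ ρ := by
  simp only [Prod.norm_def, Real.norm_eq_abs]
  exact max_le hx (max_le hy hz)

/-- A germ of `C¹` function of three variables extends to a bounded globally Lipschitz function
with the same first-order expansion. -/
lemma exists_lipBdd_extension {g : ℝ × ℝ × ℝ → ℝ} (hg : ContDiffAt ℝ 1 g 0) :
    ∃ A K ρ, 0 < ρ ∧ LipBdd A K ∧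
      (∀ x y z, |x| ≤ ρ → |y| ≤ ρ → |z| ≤ ρ → A x y z = g (x, y, z)) ∧
      FirstOrder A (g 0) (fderiv ℝ g 0 (1, 0, 0)) (fderiv ℝ g 0 (0, 1, 0))
        (fderiv ℝ g 0 (0, 0, 1)) := by
  obtain ⟨K, S, hS, hK⟩ := hg.exists_lipschitzOnWith
  obtain ⟨ρ, hρ, hρS⟩ := Metric.nhds_basis_closedBall.mem_iff.1 hS
  have hmem {x y z : ℝ} (hx : |x| ≤ ρ) (hy : |y| ≤ ρ) (hz : |z| ≤ ρ) : (x, y, z) ∈ S :=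
    hρS (by rw [mem_closedBall_zero_iff]; exact norm_triple_le hx hy hz)
  have hcl := abs_clamp_le hρ.le
  have heq (x y z : ℝ) (hx : |x| ≤ ρ) (hy : |y| ≤ ρ) (hz : |z| ≤ ρ) :
      g (clamp ρ x, clamp ρ y, clamp ρ z) = g (x, y, z) := by
    rw [clamp_of_abs_le hx, clamp_of_abs_le hy, clamp_of_abs_le hz]
  have hKρ : 0 ≤ (K : ℝ) * ρ := by positivity
  refine ⟨fun x y z ↦ g (clamp ρ x, clamp ρ y, clamp ρ z), K + |g 0| + K * ρ, ρ, hρ,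
    ⟨fun x y z x' y' z' ↦ ?_, fun x y z ↦ ?_⟩, heq, fun ε hε ↦ ?_⟩
  · have h1 := hK.dist_le_mul _ (hmem (hcl x) (hcl y) (hcl z)) _ (hmem (hcl x') (hcl y') (hcl z'))
    rw [Real.dist_eq] at h1
    refine h1.trans (mul_le_mul (by linarith [abs_nonneg (g 0)]) ?_ dist_nonneg (by positivity))
    rw [dist_eq_norm]
    have h2 := abs_clamp_sub_le ρ x x'
    have h3 := abs_clamp_sub_le ρ y y'
    have h4 := abs_clamp_sub_le ρ z z'
    have p2 := abs_nonneg (x - x')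
    have p3 := abs_nonneg (y - y')
    have p4 := abs_nonneg (z - z')
    exact norm_triple_le (by linarith) (by linarith) (by linarith)
  · have h1 := hK.dist_le_mul _ (hmem (hcl x) (hcl y) (hcl z)) 0
      (mem_of_mem_nhds hS)
    rw [Real.dist_eq, dist_zero_right] at h1
    have h2 : (K : ℝ) * ‖(clamp ρ x, clamp ρ y, clamp ρ z)‖ ≤ K * ρ :=
      mul_le_mul_of_nonneg_left (norm_triple_le (hcl x) (hcl y) (hcl z)) K.2
    have h3 := abs_sub_abs_le_abs_sub (g (clamp ρ x, clamp ρ y, clamp ρ z)) (g 0)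
    have h4 : (0 : ℝ) ≤ K := K.2
    linarith
  · have h1 := (hg.differentiableAt one_ne_zero).hasFDerivAt.isLittleO.def hε
    obtain ⟨ρ', hρ', h⟩ := Metric.nhds_basis_closedBall.mem_iff.1 h1
    refine ⟨min ρ ρ', lt_min hρ hρ', fun s hs hsρ x y w hx hy hw ↦ ?_⟩
    have hs1 := hsρ.trans (min_le_left _ _)
    have hn := norm_triple_le hx hy hw
    have h2 := h (mem_closedBall_zero_iff.2 (hn.trans (hsρ.trans (min_le_right _ _))))
    rw [mem_ofPred_eq, sub_zero] at h2
    beta_reduce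
    rw [heq x y w (hx.trans hs1) (hy.trans hs1) (hw.trans hs1)]
    refine le_trans (le_of_eq ?_) (h2.trans (mul_le_mul_of_nonneg_left hn hε.le))
    rw [Real.norm_eq_abs]
    congr 1
    have : ((x, y, w) : ℝ × ℝ × ℝ)
        = x • (1, 0, 0) + y • (0, 1, 0) + w • (0, 0, 1) := by simp
    rw [this, map_add, map_add, map_smul, map_smul, map_smul]
    simp only [smul_eq_mul]
    ring

section VectorAlgebra

open Matrix

lemma cross_cross_dot_self_left (a b : E3) :
    (b ⨯₃ (a ⨯₃ b)) ⬝ᵥ a = (a ⨯₃ b) ⬝ᵥ (a ⨯₃ b) := by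
  simp only [cross_apply, dotProduct, Fin.sum_univ_three, cons_val]
  ring

lemma cross_cross_dot_self_right (a b : E3) :
    ((a ⨯₃ b) ⨯₃ a) ⬝ᵥ b = (a ⨯₃ b) ⬝ᵥ (a ⨯₃ b) := by
  simp only [cross_apply, dotProduct, Fin.sum_univ_three, cons_val]
  ring

/-- Cramer's rule in the frame `a`, `b`, `a × b`. -/
lemma cross_decomposition (a b v : E3) :
    ((a ⨯₃ b) ⬝ᵥ (a ⨯₃ b)) • v = ((b ⨯₃ (a ⨯₃ b)) ⬝ᵥ v) • a + (((a ⨯₃ b) ⨯₃ a) ⬝ᵥ v) • b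
      + ((a ⨯₃ b) ⬝ᵥ v) • (a ⨯₃ b) := by
  ext i
  fin_cases i <;>
  · simp only [cross_apply, dotProduct, Fin.sum_univ_three, cons_val, Pi.add_apply, Pi.smul_apply,
      smul_eq_mul, Fin.reduceFinMk, Fin.zero_eta, Fin.isValue, Fin.mk_one]
    ring

lemma cross_dot_self_ne_zero {a b : E3} (h : LinearIndependent ℝ ![a, b]) :
    (a ⨯₃ b) ⬝ᵥ (a ⨯₃ b) ≠ 0 := by
  rw [Ne, dotProduct_self_eq_zero]
  exact crossProduct_ne_zero_iff_linearIndependent.2 h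

lemma continuous_cross {X : Type*} [TopologicalSpace X] {f g : X → E3} (hf : Continuous f)
    (hg : Continuous g) : Continuous fun x ↦ f x ⨯₃ g x := by
  simp only [cross_apply]
  fun_prop

lemma contDiff_cross {X : Type*} [NormedAddCommGroup X] [NormedSpace ℝ X] {n : WithTop ℕ∞}
    {f g : X → E3} (hf : ContDiff ℝ n f) (hg : ContDiff ℝ n g) :
    ContDiff ℝ n fun x ↦ f x ⨯₃ g x := by
  rw [contDiff_pi] at *
  intro i
  fin_cases i
  · exact ((hf 1).mul (hg 2)).sub ((hf 2).mul (hg 1))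
  · exact ((hf 2).mul (hg 0)).sub ((hf 0).mul (hg 2))
  · exact ((hf 0).mul (hg 1)).sub ((hf 1).mul (hg 0))

lemma contDiff_dotProduct {X : Type*} [NormedAddCommGroup X] [NormedSpace ℝ X] {n : WithTop ℕ∞}
    {f g : X → E3} (hf : ContDiff ℝ n f) (hg : ContDiff ℝ n g) :
    ContDiff ℝ n fun x ↦ f x ⬝ᵥ g x := by
  rw [contDiff_pi] at *
  exact ContDiff.sum fun i _ ↦ (hf i).mul (hg i)

lemma hasDerivAt_cross_dot {f g : ℝ → E3} {f' g' : E3} {t : ℝ} (hf : HasDerivAt f f' t)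
    (hg : HasDerivAt g g' t) (v : E3) :
    HasDerivAt (fun t ↦ (f t ⨯₃ g t) ⬝ᵥ v) ((f' ⨯₃ g t + f t ⨯₃ g') ⬝ᵥ v) t := by
  rw [hasDerivAt_pi] at *
  simp only [cross_apply, dotProduct, Fin.sum_univ_three, cons_val]
  refine ((((hf 1).mul (hg 2)).sub ((hf 2).mul (hg 1))).mul_const (v 0)).add
    ((((hf 2).mul (hg 0)).sub ((hf 0).mul (hg 2))).mul_const (v 1)) |>.add
    ((((hf 0).mul (hg 1)).sub ((hf 1).mul (hg 0))).mul_const (v 2)) |>.congr_deriv ?_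
  simp only [Pi.add_apply, cons_val]
  ring

lemma exists_clm_eq_dotProduct (w : E3) : ∃ φ : E3 →L[ℝ] ℝ, ∀ v, φ v = w ⬝ᵥ v :=
  ⟨LinearMap.toContinuousLinearMap (dotProductBilin ℝ ℝ w), fun _ ↦ rfl⟩

end VectorAlgebra

section Contact

open Matrix

/-- The affine chart centred at `p` with axes `a`, `b` and `a × b`. -/
def framePoint (p a b : E3) (x : ℝ × ℝ × ℝ) : E3 :=
  p + x.1 • a + x.2.1 • b + x.2.2 • (a ⨯₃ b)

lemma framePoint_zero (p a b : E3) : framePoint p a b 0 = p := by simp [framePoint]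

lemma contDiff_framePoint (p a b : E3) {n : WithTop ℕ∞} : ContDiff ℝ n (framePoint p a b) := by
  unfold framePoint
  fun_prop

lemma hasDerivAt_comp_line {f : E3 → E3} {p : E3} (hf : DifferentiableAt ℝ f p) (v : E3) :
    HasDerivAt (fun t : ℝ ↦ f (p + t • v)) (fderiv ℝ f p v) 0 := by
  have h1 : HasDerivAt (fun t : ℝ ↦ p + t • v) v 0 := by
    simpa using ((hasDerivAt_id (0 : ℝ)).smul_const v).const_add p
  have h2 : HasFDerivAt f (fderiv ℝ f p) (p + (0 : ℝ) • v) := by simpa using hf.hasFDerivAt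
  exact h2.comp_hasDerivAt 0 h1

/-- The derivative of a quotient of covector fields along a line on which the numerator vanishes at
the origin. -/
lemma hasDerivAt_neg_cross_dot_div {f g : E3 → E3} {p : E3} (hf : DifferentiableAt ℝ f p)
    (hg : DifferentiableAt ℝ g p) (v w m : E3) (hw : (f p ⨯₃ g p) ⬝ᵥ w = 0)
    (hm : (f p ⨯₃ g p) ⬝ᵥ m ≠ 0) :
    HasDerivAt (fun t : ℝ ↦ -((f (p + t • v) ⨯₃ g (p + t • v)) ⬝ᵥ w)
      / ((f (p + t • v) ⨯₃ g (p + t • v)) ⬝ᵥ m))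
      (-((fderiv ℝ f p v ⨯₃ g p + f p ⨯₃ fderiv ℝ g p v) ⬝ᵥ w) / ((f p ⨯₃ g p) ⬝ᵥ m)) 0 := by
  have h1 := hasDerivAt_cross_dot (hasDerivAt_comp_line hf v) (hasDerivAt_comp_line hg v) w
  have h2 := hasDerivAt_cross_dot (hasDerivAt_comp_line hf v) (hasDerivAt_comp_line hg v) m
  refine (h1.neg.div h2 (by simpa using hm)).congr_deriv ?_
  simp only [Pi.neg_apply, zero_smul, add_zero, hw]
  field_simp
  ring

variable {f0 f1 f2 : E3 → E3}

/-- The plane field spanned by `f1` and `f2`, translated by `f0`, written as a graph over the first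
two coordinates of an affine chart. -/
lemma exists_contact_coefficients (hf0 : ContDiff ℝ 1 f0) (hf1 : ContDiff ℝ 1 f1)
    (hf2 : ContDiff ℝ 1 f2) {p : E3} (hli : LinearIndependent ℝ ![f1 p, f2 p])
    (hn : (f1 p ⨯₃ f2 p) ⬝ᵥ lie f1 f2 p ≠ 0) :
    ∃ (A B C : ℝ → ℝ → ℝ → ℝ) (K ρ a1 a2 a3 b1 b2 b3 c1 c2 c3 : ℝ), 0 < ρ ∧
      LipBdd A K ∧ LipBdd B K ∧ LipBdd C K ∧
      FirstOrder A 0 a1 a2 a3 ∧ FirstOrder B 0 b1 b2 b3 ∧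
      FirstOrder C (((f1 p ⨯₃ f2 p) ⬝ᵥ f0 p) / ((f1 p ⨯₃ f2 p) ⬝ᵥ (f1 p ⨯₃ f2 p))) c1 c2 c3 ∧
      b1 - a2 ≠ 0 ∧ ∀ x y z, |x| ≤ ρ → |y| ≤ ρ → |z| ≤ ρ → ∀ q,
        q = framePoint p (f1 p) (f2 p) (x, y, z) → ∀ x' y' z',
        ((f1 q ⨯₃ f2 q) ⬝ᵥ (x' • f1 p + y' • f2 p + z' • (f1 p ⨯₃ f2 p) - f0 q) = 0 ↔
          z' = C x y z + A x y z * x' + B x y z * y') := by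
  have hN := cross_dot_self_ne_zero hli
  have hω1 : (f1 p ⨯₃ f2 p) ⬝ᵥ f1 p = 0 := by rw [dotProduct_comm, dot_self_cross]
  have hω2 : (f1 p ⨯₃ f2 p) ⬝ᵥ f2 p = 0 := by rw [dotProduct_comm, dot_cross_self]
  have hd1 := hf1.differentiable one_ne_zero p
  have hd2 := hf2.differentiable one_ne_zero p
  set a := f1 p with ha
  set b := f2 p with hb
  set n := a ⨯₃ b with hnab
  obtain ⟨Φ, hΦ⟩ : ∃ Φ, Φ = framePoint p a b := ⟨_, rfl⟩
  have hΦ0 : Φ 0 = p := by rw [hΦ, framePoint_zero]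
  have hΦs : ContDiff ℝ 1 Φ := hΦ ▸ contDiff_framePoint p a b
  obtain ⟨ω, hω⟩ : ∃ ω : ℝ × ℝ × ℝ → E3, ω = fun x ↦ f1 (Φ x) ⨯₃ f2 (Φ x) := ⟨_, rfl⟩
  have hωs : ContDiff ℝ 1 ω := hω ▸ contDiff_cross (hf1.comp hΦs) (hf2.comp hΦs)
  have hω0 : ω 0 = n := by simp only [hω, hΦ0, hnab, ha, hb]
  have hden : ContDiff ℝ 1 fun x ↦ ω x ⬝ᵥ n := contDiff_dotProduct hωs contDiff_const
  have hden0 : ω 0 ⬝ᵥ n ≠ 0 := by rwa [hω0]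
  have hA : ContDiffAt ℝ 1 (fun x ↦ -(ω x ⬝ᵥ a) / (ω x ⬝ᵥ n)) 0 :=
    (contDiff_dotProduct hωs contDiff_const).neg.contDiffAt.div hden.contDiffAt hden0
  have hB : ContDiffAt ℝ 1 (fun x ↦ -(ω x ⬝ᵥ b) / (ω x ⬝ᵥ n)) 0 :=
    (contDiff_dotProduct hωs contDiff_const).neg.contDiffAt.div hden.contDiffAt hden0
  have hC : ContDiffAt ℝ 1 (fun x ↦ (ω x ⬝ᵥ f0 (Φ x)) / (ω x ⬝ᵥ n)) 0 :=
    (contDiff_dotProduct hωs (hf0.comp hΦs)).contDiffAt.div hden.contDiffAt hden0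
  obtain ⟨A, K1, ρ1, hρ1, hAL, hAe, hAf⟩ := exists_lipBdd_extension hA
  obtain ⟨B, K2, ρ2, hρ2, hBL, hBe, hBf⟩ := exists_lipBdd_extension hB
  obtain ⟨C, K3, ρ3, hρ3, hCL, hCe, hCf⟩ := exists_lipBdd_extension hC
  obtain ⟨ρ4, hρ4, hne⟩ := Metric.nhds_basis_closedBall.mem_iff.1
    (hden.continuous.continuousAt.eventually_ne hden0)
  have hK1 := hAL.nonneg
  have hK2 := hBL.nonneg
  have hK3 := hCL.nonneg
  refine ⟨A, B, C, K1 + K2 + K3, min (min ρ1 ρ2) (min ρ3 ρ4), _, _, _, _, _, _, _, _, _,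
    by positivity, hAL.mono (by linarith), hBL.mono (by linarith), hCL.mono (by linarith),
    by simpa only [hω0, hω1, neg_zero, zero_div] using hAf,
    by simpa only [hω0, hω2, neg_zero, zero_div] using hBf,
    by simpa only [hω0, hΦ0] using hCf, ?_, ?_⟩
  · have hline {v : ℝ × ℝ × ℝ} {w : E3} (hv : ∀ t : ℝ, Φ (t • v) = p + t • w) {c : E3}
        (hc : n ⬝ᵥ c = 0) (hg : ContDiffAt ℝ 1 (fun x ↦ -(ω x ⬝ᵥ c) / (ω x ⬝ᵥ n)) 0) :
        fderiv ℝ (fun x ↦ -(ω x ⬝ᵥ c) / (ω x ⬝ᵥ n)) 0 v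
          = -((fderiv ℝ f1 p w ⨯₃ b + a ⨯₃ fderiv ℝ f2 p w) ⬝ᵥ c) / (n ⬝ᵥ n) := by
      have h1 := (hg.differentiableAt one_ne_zero).hasFDerivAt.hasLineDerivAt v
      refine HasDerivAt.unique h1 ?_
      have h2 := hasDerivAt_neg_cross_dot_div hd1 hd2 w c n hc hN
      simpa only [zero_add, hω, hv] using h2
    rw [hline (w := a) (fun t ↦ by simp [hΦ, framePoint]) hω2 hB,
      hline (w := b) (fun t ↦ by simp [hΦ, framePoint]) hω1 hA, ← sub_div]
    refine div_ne_zero ?_ hN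
    convert hn using 1
    rw [lie, ← ha, ← hb, hnab]
    generalize fderiv ℝ f2 p a = u
    generalize fderiv ℝ f1 p b = w
    generalize fderiv ℝ f1 p a = u'
    generalize fderiv ℝ f2 p b = w'
    simp only [cross_apply, dotProduct, Fin.sum_univ_three, cons_val, Pi.add_apply, Pi.sub_apply]
    ring
  · intro x y z hx hy hz q hq x' y' z'
    simp only [le_min_iff] at hx hy hz
    rw [hAe x y z hx.1.1 hy.1.1 hz.1.1, hBe x y z hx.1.2 hy.1.2 hz.1.2,
      hCe x y z hx.2.1 hy.2.1 hz.2.1]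
    have hnz : ω (x, y, z) ⬝ᵥ n ≠ 0 := hne (mem_closedBall_zero_iff.2
      (norm_triple_le hx.2.2 hy.2.2 hz.2.2))
    have hωq : f1 q ⨯₃ f2 q = ω (x, y, z) := by rw [hω, hq, hΦ]
    rw [hωq, hq, ← hΦ]
    simp only [dotProduct_add, dotProduct_sub, dotProduct_smul, smul_eq_mul]
    field_simp
    constructor <;> intro h <;> linarith

end Contact

/-- The point `p'` is reached from `p` by an admissible trajectory in time `T`. -/
def Reach (f0 f1 f2 : E3 → E3) (p : E3) (T : ℝ) (p' : E3) : Prop :=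
  ∃ (u : ℝ → ℝ × ℝ) (γ : ℝ → E3), AdmControl u (Icc 0 T) ∧ IsTraj f0 f1 f2 u γ (Icc 0 T) ∧
    γ 0 = p ∧ γ T = p'

section Reach

variable {f0 f1 f2 : E3 → E3}

lemma ae_ne_real (a : ℝ) : ∀ᵐ t : ℝ, t ≠ a := by simp [ae_iff]

lemma IsTraj.shift {u : ℝ → ℝ × ℝ} {q : ℝ → E3} {a b c : ℝ}
    (h : IsTraj f0 f1 f2 u q (Icc 0 c)) (ha : 0 ≤ a) (hb : b ≤ c) :
    IsTraj f0 f1 f2 (fun t ↦ u (t + a)) (fun t ↦ q (t + a)) (Icc 0 (b - a)) := by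
  have hmem {t : ℝ} (ht : t ∈ Icc 0 (b - a)) : t + a ∈ Icc 0 c :=
    ⟨by linarith [ht.1], by linarith [ht.2]⟩
  obtain ⟨⟨K, hK⟩, hd⟩ := h
  refine ⟨⟨K, LipschitzOnWith.of_dist_le_mul fun s hs t ht ↦ ?_⟩, ?_⟩
  · simpa using hK.dist_le_mul _ (hmem hs) _ (hmem ht)
  · filter_upwards [(measurePreserving_add_right volume a).quasiMeasurePreserving.ae hd]
      with t ht htI
    exact (ht (hmem htI)).comp_add_const t a

lemma IsTraj.reach {u : ℝ → ℝ × ℝ} {q : ℝ → E3} {a b c : ℝ}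
    (h : IsTraj f0 f1 f2 u q (Icc 0 c)) (hu : AdmControl u (Icc 0 c)) (ha : 0 ≤ a) (hb : b ≤ c) :
    Reach f0 f1 f2 (q a) (b - a) (q b) := by
  refine ⟨fun t ↦ u (t + a), fun t ↦ q (t + a),
    ⟨hu.1.comp (measurable_id.add_const a), fun t ht ↦ hu.2 _ ⟨?_, ?_⟩⟩, h.shift ha hb,
    by simp, by simp⟩
  · linarith [ht.1]
  · linarith [ht.2]

lemma Reach.trans {p p' p'' : E3} {T T' : ℝ} (h : Reach f0 f1 f2 p T p')
    (h' : Reach f0 f1 f2 p' T' p'') (hT : 0 ≤ T) (hT' : 0 ≤ T') :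
    Reach f0 f1 f2 p (T + T') p'' := by
  obtain ⟨u, γ, hu, ⟨⟨K, hK⟩, hd⟩, h0, h1⟩ := h
  obtain ⟨u', γ', hu', ⟨⟨K', hK'⟩, hd'⟩, h0', hend'⟩ := h'
  have hfst {t : ℝ} (ht : t ∈ Icc 0 (T + T')) (htT : t ≤ T) : t ∈ Icc 0 T := ⟨ht.1, htT⟩
  have hsnd {t : ℝ} (ht : t ∈ Icc 0 (T + T')) (htT : T ≤ t) : t - T ∈ Icc 0 T' :=
    ⟨by linarith, by linarith [ht.2]⟩
  refine ⟨fun t ↦ if t ≤ T then u t else u' (t - T), fun t ↦ if t ≤ T then γ t else γ' (t - T),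
    ⟨Measurable.ite measurableSet_Iic hu.1 (hu'.1.comp (measurable_id.sub_const T)),
      fun t ht ↦ ?_⟩, ⟨⟨K + K', ?_⟩, ?_⟩, by simpa [hT] using h0, ?_⟩
  · dsimp only
    split_ifs with htT
    · exact hu.2 t (hfst ht htT)
    · exact hu'.2 _ (hsnd ht (not_le.1 htT).le)
  · refine LipschitzOnWith.of_dist_le_mul fun s hs t ht ↦ ?_
    wlog hst : s ≤ t generalizing s t
    · rw [dist_comm, dist_comm s]
      exact this t ht s hs (not_le.1 hst).le
    have hK0 : (0 : ℝ) ≤ K := K.2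
    have hK0' : (0 : ℝ) ≤ K' := K'.2
    have hdst : dist s t = t - s := by rw [dist_comm, Real.dist_eq, abs_of_nonneg (by linarith)]
    rw [hdst]
    push_cast
    have q1 := mul_nonneg hK0 (sub_nonneg.2 hst)
    have q2 := mul_nonneg hK0' (sub_nonneg.2 hst)
    split_ifs with hsT htT htT
    · have := hK.dist_le_mul s (hfst hs hsT) t (hfst ht htT)
      rw [hdst] at this
      linarith
    · have htT' := (not_le.1 htT).le
      have b1 := hK.dist_le_mul s (hfst hs hsT) T ⟨hT, le_rfl⟩
      have b2 := hK'.dist_le_mul 0 ⟨le_rfl, hT'⟩ (t - T) (hsnd ht htT')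
      rw [h1, dist_comm s, Real.dist_eq, abs_of_nonneg (by linarith)] at b1
      rw [h0', dist_comm 0, Real.dist_eq, sub_zero, abs_of_nonneg (by linarith)] at b2
      have b3 := mul_le_mul_of_nonneg_left (show T - s ≤ t - s by linarith) hK0
      have b4 := mul_le_mul_of_nonneg_left (show t - T ≤ t - s by linarith) hK0'
      linarith [dist_triangle (γ s) p' (γ' (t - T))]
    · exact absurd (hst.trans htT) hsT
    · have := hK'.dist_le_mul (s - T) (hsnd hs (not_le.1 hsT).le) (t - T)
        (hsnd ht (not_le.1 htT).le)
      rw [dist_sub_right, hdst] at this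
      linarith
  · filter_upwards [hd, (measurePreserving_sub_right volume T).quasiMeasurePreserving.ae hd',
      ae_ne_real T] with t ht ht' hne htI
    rcases lt_or_gt_of_ne hne with hlt | hgt
    · have he : (fun t ↦ if t ≤ T then γ t else γ' (t - T)) =ᶠ[nhds t] γ := by
        filter_upwards [Iio_mem_nhds hlt] with r hr
        exact if_pos (le_of_lt hr)
      simp only [hlt.le, if_true]
      exact (ht (hfst htI hlt.le)).congr_of_eventuallyEq he
    · have he : (fun t ↦ if t ≤ T then γ t else γ' (t - T)) =ᶠ[nhds t] fun t ↦ γ' (t - T) := by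
        filter_upwards [Ioi_mem_nhds hgt] with r hr
        exact if_neg (not_le.2 hr)
      simp only [not_le.2 hgt, if_false]
      exact ((ht' (hsnd htI hgt.le)).comp_sub_const t T).congr_of_eventuallyEq he
  · rcases hT'.eq_or_lt with rfl | hlt
    · simp [h1, ← hend', h0']
    · simp [hend', hlt]

/-- A `C¹` curve driven by a continuous control is an admissible trajectory. -/
lemma reach_of_hasDerivWithinAt (hf0 : Continuous f0) (hf1 : Continuous f1) (hf2 : Continuous f2)
    {s : ℝ} (hs : 0 ≤ s) {γ : ℝ → E3} {w : ℝ → ℝ × ℝ} (hw : ContinuousOn w (Icc 0 s))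
    (hwU : ∀ t ∈ Icc 0 s, w t ∈ U2)
    (hγ : ∀ t ∈ Icc 0 s, HasDerivWithinAt γ
      (f0 (γ t) + (w t).1 • f1 (γ t) + (w t).2 • f2 (γ t)) (Icc 0 s) t) :
    Reach f0 f1 f2 (γ 0) s (γ s) := by
  have hext {t : ℝ} (ht : t ∈ Icc 0 s) : IccExtend hs ((Icc 0 s).domRestrict w) t = w t :=
    IccExtend_of_mem hs _ ht
  have hγc : ContinuousOn γ (Icc 0 s) := fun t ht ↦ (hγ t ht).continuousWithinAt
  have hdc : ContinuousOn (fun t ↦ f0 (γ t) + (w t).1 • f1 (γ t) + (w t).2 • f2 (γ t))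
      (Icc 0 s) := by
    have c0 := hf0.comp_continuousOn hγc
    have c1 := hf1.comp_continuousOn hγc
    have c2 := hf2.comp_continuousOn hγc
    exact (c0.add (hw.fst.smul c1)).add (hw.snd.smul c2)
  obtain ⟨R, hR⟩ := isCompact_Icc.exists_bound_of_continuousOn hdc
  have hR0 : 0 ≤ R := (norm_nonneg _).trans (hR 0 (left_mem_Icc.2 hs))
  refine ⟨IccExtend hs ((Icc 0 s).domRestrict w), γ,
    ⟨(hw.domRestrict.Icc_extend').measurable, fun t ht ↦ ?_⟩, ⟨⟨R.toNNReal, ?_⟩, ?_⟩, rfl, rfl⟩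
  · rw [hext ht]
    exact hwU t ht
  · refine Convex.lipschitzOnWith_of_nnnorm_hasDerivWithin_le (convex_Icc 0 s) hγ fun t ht ↦ ?_
    rw [← NNReal.coe_le_coe, coe_nnnorm, Real.coe_toNNReal _ hR0]
    exact hR t ht
  · filter_upwards [ae_ne_real 0, ae_ne_real s] with t h0 hts ht
    rw [hext ht]
    exact (hγ t ht).hasDerivAt (Icc_mem_nhds (lt_of_le_of_ne ht.1 h0.symm)
      (lt_of_le_of_ne ht.2 hts))

end Reach

section LieShortcut

open Matrix

variable {f0 f1 f2 : E3 → E3}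

/-- The first coordinate of `v` in the frame `f1 q`, `f2 q`, `f1 q × f2 q`. -/
def controlFst (f1 f2 : E3 → E3) (q v : E3) : ℝ :=
  ((f2 q ⨯₃ (f1 q ⨯₃ f2 q)) ⬝ᵥ v) / ((f1 q ⨯₃ f2 q) ⬝ᵥ (f1 q ⨯₃ f2 q))

/-- The second coordinate of `v` in the frame `f1 q`, `f2 q`, `f1 q × f2 q`. -/
def controlSnd (f1 f2 : E3 → E3) (q v : E3) : ℝ :=
  (((f1 q ⨯₃ f2 q) ⨯₃ f1 q) ⬝ᵥ v) / ((f1 q ⨯₃ f2 q) ⬝ᵥ (f1 q ⨯₃ f2 q))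

lemma control_smul_add {q v : E3} (hli : LinearIndependent ℝ ![f1 q, f2 q])
    (hv : (f1 q ⨯₃ f2 q) ⬝ᵥ v = 0) :
    controlFst f1 f2 q v • f1 q + controlSnd f1 f2 q v • f2 q = v := by
  have hN := cross_dot_self_ne_zero hli
  have h := cross_decomposition (f1 q) (f2 q) v
  rw [hv, zero_smul, add_zero] at h
  rw [← smul_right_injective E3 hN |>.eq_iff, h, smul_add, smul_smul, smul_smul, controlFst,
    controlSnd, mul_div_cancel₀ _ hN, mul_div_cancel₀ _ hN]

lemma controlFst_eq {q : E3} (hli : LinearIndependent ℝ ![f1 q, f2 q]) (u : ℝ × ℝ) :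
    controlFst f1 f2 q (u.1 • f1 q + u.2 • f2 q) = u.1 := by
  rw [controlFst, dotProduct_add, dotProduct_smul, dotProduct_smul, cross_cross_dot_self_left,
    dotProduct_comm _ (f2 q), dot_self_cross, smul_zero, add_zero, smul_eq_mul,
    mul_div_cancel_right₀ _ (cross_dot_self_ne_zero hli)]

lemma controlSnd_eq {q : E3} (hli : LinearIndependent ℝ ![f1 q, f2 q]) (u : ℝ × ℝ) :
    controlSnd f1 f2 q (u.1 • f1 q + u.2 • f2 q) = u.2 := by
  rw [controlSnd, dotProduct_add, dotProduct_smul, dotProduct_smul, cross_cross_dot_self_right,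
    dotProduct_comm _ (f1 q), dot_cross_self, smul_zero, zero_add, smul_eq_mul,
    mul_div_cancel_right₀ _ (cross_dot_self_ne_zero hli)]

lemma continuous_control (hf1 : Continuous f1) (hf2 : Continuous f2)
    (hli : ∀ q, LinearIndependent ℝ ![f1 q, f2 q]) {X : Type*} [TopologicalSpace X]
    {g h : X → E3} (hg : Continuous g) (hh : Continuous h) :
    Continuous fun x ↦ (controlFst f1 f2 (g x) (h x), controlSnd f1 f2 (g x) (h x)) := by
  have c1 := hf1.comp hg
  have c2 := hf2.comp hg
  have c3 := continuous_cross c1 c2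
  exact (((continuous_cross c2 c3).dotProduct hh).div (c3.dotProduct c3)
    fun x ↦ cross_dot_self_ne_zero (hli _)).prodMk
    (((continuous_cross c3 c1).dotProduct hh).div (c3.dotProduct c3)
    fun x ↦ cross_dot_self_ne_zero (hli _))

/-- Linear coordinates in the frame `a`, `b`, `a × b`. -/
lemma exists_frame_coordinates {a b : E3} (hli : LinearIndependent ℝ ![a, b]) :
    ∃ φ1 φ2 φ3 : E3 →L[ℝ] ℝ, ∀ v, v = φ1 v • a + φ2 v • b + φ3 v • (a ⨯₃ b) := by
  have hN := cross_dot_self_ne_zero hli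
  obtain ⟨φ1, h1⟩ := exists_clm_eq_dotProduct
    (((a ⨯₃ b) ⬝ᵥ (a ⨯₃ b))⁻¹ • (b ⨯₃ (a ⨯₃ b)))
  obtain ⟨φ2, h2⟩ := exists_clm_eq_dotProduct
    (((a ⨯₃ b) ⬝ᵥ (a ⨯₃ b))⁻¹ • ((a ⨯₃ b) ⨯₃ a))
  obtain ⟨φ3, h3⟩ := exists_clm_eq_dotProduct
    (((a ⨯₃ b) ⬝ᵥ (a ⨯₃ b))⁻¹ • (a ⨯₃ b))
  refine ⟨φ1, φ2, φ3, fun v ↦ ?_⟩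
  rw [← smul_right_injective E3 hN |>.eq_iff]
  rw [cross_decomposition, h1, h2, h3]
  simp only [smul_add, smul_smul, smul_dotProduct, smul_eq_mul]
  rw [mul_inv_cancel_left₀ hN, mul_inv_cancel_left₀ hN, mul_inv_cancel_left₀ hN]

lemma cross_dot_combination (a b : E3) (u v : ℝ) : (a ⨯₃ b) ⬝ᵥ (u • a + v • b) = 0 := by
  rw [dotProduct_add, dotProduct_smul, dotProduct_smul, dotProduct_comm _ a, dotProduct_comm _ b,
    dot_self_cross, dot_cross_self, smul_zero, smul_zero, add_zero]

/-- Where `f1`, `f2` and `[f1, f2]` are independent, a trajectory starting with a control interior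
to the disk is not time-optimal on any interval. -/
lemma exists_faster_trajectory (hf0 : ContDiff ℝ 1 f0) (hf1 : ContDiff ℝ 1 f1)
    (hf2 : ContDiff ℝ 1 f2) (hli : ∀ q, LinearIndependent ℝ ![f1 q, f2 q])
    {q : ℝ → E3} {u : ℝ → ℝ × ℝ} {T : ℝ} (hT : 0 < T) (hq : IsTraj f0 f1 f2 u q (Icc 0 T))
    {u0 : ℝ × ℝ} (hu0 : u0.1 ^ 2 + u0.2 ^ 2 < 1)
    (hq0 : HasDerivAt q (f0 (q 0) + u0.1 • f1 (q 0) + u0.2 • f2 (q 0)) 0)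
    (hn : (f1 (q 0) ⨯₃ f2 (q 0)) ⬝ᵥ lie f1 f2 (q 0) ≠ 0) :
    ∃ τ ∈ Ioc 0 T, ∃ s ∈ Ioo 0 τ, Reach f0 f1 f2 (q 0) s (q τ) := by
  obtain ⟨⟨K, hK⟩, hd⟩ := hq
  obtain ⟨p, hp⟩ : ∃ p, p = q 0 := ⟨_, rfl⟩
  rw [← hp] at hq0 hn ⊢
  obtain ⟨A, B, C, K', ρ, a1, a2, a3, b1, b2, b3, c1, c2, c3, hρ, hA, hB, hC, hfA, hfB, hfC, hκ,
    hiff⟩ := exists_contact_coefficients hf0 hf1 hf2 (hli p) hn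
  obtain ⟨φ1, φ2, φ3, hφ⟩ := exists_frame_coordinates (hli p)
  generalize ha : f1 p = a at *
  generalize hb : f2 p = b at *
  have hqΦ (t : ℝ) : q t = framePoint p a b (φ1 (q t - p), φ2 (q t - p), φ3 (q t - p)) := by
    have := hφ (q t - p)
    rw [framePoint, add_assoc, add_assoc, ← add_assoc (_ • a), ← this, add_sub_cancel]
  obtain ⟨v0, hv0⟩ : ∃ v0, v0 = f0 p + u0.1 • a + u0.2 • b := ⟨_, rfl⟩
  rw [← hv0] at hq0
  -- the velocity with planar part `(x', y')` over the point with coordinates `(x, y, z)`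
  obtain ⟨V, hV⟩ : ∃ V : ℝ × ℝ × ℝ × ℝ × ℝ → E3, V = fun P ↦
      P.2.2.2.1 • a + P.2.2.2.2 • b + (C P.1 P.2.1 P.2.2.1 + A P.1 P.2.1 P.2.2.1 * P.2.2.2.1
        + B P.1 P.2.1 P.2.2.1 * P.2.2.2.2) • (a ⨯₃ b) := ⟨_, rfl⟩
  obtain ⟨Φ, hΦ⟩ : ∃ Φ : ℝ × ℝ × ℝ × ℝ × ℝ → E3, Φ = fun P ↦
      framePoint p a b (P.1, P.2.1, P.2.2.1) := ⟨_, rfl⟩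
  have hΦc : Continuous Φ := by
    rw [hΦ]
    exact (contDiff_framePoint p a b (n := 1)).continuous.comp (by fun_prop)
  have hVc : Continuous V := by
    have hc : Continuous fun P : ℝ × ℝ × ℝ × ℝ × ℝ ↦ (P.1, P.2.1, P.2.2.1) := by fun_prop
    have cA := hA.continuous.comp hc
    have cB := hB.continuous.comp hc
    have cC := hC.continuous.comp hc
    simp only [Function.comp_def] at cA cB cC
    rw [hV]
    have c1 : Continuous fun P : ℝ × ℝ × ℝ × ℝ × ℝ ↦ P.2.2.2.1 := by fun_prop
    have c2 : Continuous fun P : ℝ × ℝ × ℝ × ℝ × ℝ ↦ P.2.2.2.2 := by fun_prop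
    exact ((c1.smul continuous_const).add (c2.smul continuous_const)).add
      (((cC.add (cA.mul c1)).add (cB.mul c2)).smul continuous_const)
  have hUc := continuous_control hf1.continuous hf2.continuous hli hΦc
    (hVc.sub (hf0.continuous.comp hΦc))
  obtain ⟨U, hU⟩ : ∃ U : ℝ × ℝ × ℝ × ℝ × ℝ → ℝ × ℝ, U = fun P ↦
      (controlFst f1 f2 (Φ P) (V P - f0 (Φ P)), controlSnd f1 f2 (Φ P) (V P - f0 (Φ P))) :=
    ⟨_, rfl⟩
  replace hUc : Continuous U := by rw [hU]; exact hUc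
  have hω0 : (a ⨯₃ b) ⬝ᵥ (v0 - f0 p) = 0 := by
    rw [hv0, add_assoc, add_sub_cancel_left, cross_dot_combination]
  have hU0 : U (0, 0, 0, φ1 v0, φ2 v0) = u0 := by
    have hΦ0 : Φ (0, 0, 0, φ1 v0, φ2 v0) = p := by rw [hΦ]; exact framePoint_zero p a b
    have hz := (hiff 0 0 0 (by simpa using hρ.le) (by simpa using hρ.le) (by simpa using hρ.le) p
      (framePoint_zero p a b).symm (φ1 v0) (φ2 v0) (φ3 v0)).1 (by rw [← hφ, ha, hb]; exact hω0)
    have hV0 : V (0, 0, 0, φ1 v0, φ2 v0) = v0 := by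
      rw [hV]
      beta_reduce
      rw [← hz, ← hφ]
    rw [hU]
    beta_reduce
    rw [hΦ0, hV0, hv0, add_assoc, add_sub_cancel_left, ← ha, ← hb, controlFst_eq (hli p),
      controlSnd_eq (hli p)]
  have hopen : IsOpen {P | (U P).1 ^ 2 + (U P).2 ^ 2 < 1} :=
    isOpen_lt (by fun_prop) continuous_const
  obtain ⟨η0, hη0, hball⟩ := Metric.nhds_basis_closedBall.mem_iff.1
    (hopen.mem_nhds (show (0, 0, 0, φ1 v0, φ2 v0) ∈ _ by rw [mem_ofPred_eq, hU0]; exact hu0))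
  -- restrict to a time interval on which the coordinates stay in the cube
  have hlip (φ : E3 →L[ℝ] ℝ) :
      LipschitzOnWith (‖φ‖₊ * K) (fun t ↦ φ (q t - p)) (Icc 0 T) :=
    LipschitzOnWith.of_dist_le_mul fun s hs t ht ↦ by
      rw [map_sub, map_sub, dist_sub_right]
      exact (φ.lipschitz.comp_lipschitzOnWith hK).dist_le_mul s hs t ht
  obtain ⟨L, hL⟩ : ∃ L, L = (‖φ1‖₊ + ‖φ2‖₊ + ‖φ3‖₊) * K := ⟨_, rfl⟩
  have hlip1 := (hlip φ1).weaken (show ‖φ1‖₊ * K ≤ L by rw [hL]; gcongr; rw [add_assoc]; simp)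
  have hlip2 := (hlip φ2).weaken (show ‖φ2‖₊ * K ≤ L by
    rw [hL]; gcongr; rw [add_comm ‖φ1‖₊, add_assoc]; simp)
  have hlip3 := (hlip φ3).weaken (show ‖φ3‖₊ * K ≤ L by rw [hL]; gcongr; simp)
  obtain ⟨T', hT', hTT', hLT'⟩ : ∃ T' > 0, T' ≤ T ∧ (L : ℝ) * T' ≤ ρ := by
    refine ⟨min T (ρ / (L + 1)), by positivity, min_le_left _ _, ?_⟩
    have h1 := min_le_right T (ρ / ((L : ℝ) + 1))
    rw [le_div_iff₀ (by positivity)] at h1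
    have h2 : 0 < min T (ρ / ((L : ℝ) + 1)) := by positivity
    linarith
  have hsub : Icc 0 T' ⊆ Icc 0 T := Icc_subset_Icc_right hTT'
  have hcube {φ : E3 →L[ℝ] ℝ} (h : LipschitzOnWith L (fun t ↦ φ (q t - p)) (Icc 0 T)) {t : ℝ}
      (ht : t ∈ Icc 0 T') : |φ (q t - p)| ≤ ρ := by
    have h1 := h.dist_le_mul t (hsub ht) 0 ⟨le_rfl, hT.le⟩
    rw [← hp, sub_self, map_zero, dist_zero_right, dist_zero_right, Real.norm_eq_abs,
      Real.norm_eq_abs, abs_of_nonneg ht.1] at h1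
    exact h1.trans ((mul_le_mul_of_nonneg_left ht.2 L.2).trans hLT')
  have hderiv (φ : E3 →L[ℝ] ℝ) {v : E3} {t : ℝ} (h : HasDerivAt q v t) :
      HasDerivAt (fun t ↦ φ (q t - p)) (φ v) t :=
    φ.hasFDerivAt.comp_hasDerivAt t (h.sub_const p)
  obtain ⟨τ, hτ, s, hs, X, Y, Z, X', Y', hX0, hY0, hZ0, hXs, hYs, hZs, hX'c, hY'c, h⟩ :=
    exists_faster_contact_curve hA hB hC hfA hfB hfC hκ (η := min η0 ρ) hT' (hlip1.mono hsub)
      (hlip2.mono hsub) (hlip3.mono hsub) (by simp [hp]) (by simp [hp]) (by simp [hp])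
      (hderiv φ1 hq0).hasDerivWithinAt (hderiv φ2 hq0).hasDerivWithinAt
      (x' := fun t ↦ φ1 (f0 (q t) + (u t).1 • f1 (q t) + (u t).2 • f2 (q t)))
      (y' := fun t ↦ φ2 (f0 (q t) + (u t).1 • f1 (q t) + (u t).2 • f2 (q t)))
      (by
        filter_upwards [hd] with t ht htI
        have ht' := ht (hsub htI)
        refine ⟨hderiv φ1 ht', hderiv φ2 ht', (hderiv φ3 ht').congr_deriv ?_⟩
        refine (hiff _ _ _ (hcube hlip1 htI) (hcube hlip2 htI) (hcube hlip3 htI) _ (hqΦ t)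
          _ _ _).1 ?_
        rw [← hφ, add_assoc, add_sub_cancel_left, cross_dot_combination])
      (lt_min hη0 hρ)
  obtain ⟨P, hP⟩ : ∃ P : ℝ → ℝ × ℝ × ℝ × ℝ × ℝ, P = fun t ↦ (X t, Y t, Z t, X' t, Y' t) :=
    ⟨_, rfl⟩
  refine ⟨τ, ⟨hτ.1, hτ.2.trans hTT'⟩, s, hs, ?_⟩
  have hPc : ContinuousOn P (Icc 0 s) := by
    rw [hP]
    have cX : ContinuousOn X (Icc 0 s) := fun t ht ↦ (h t ht).2.2.2.2.2.1.continuousWithinAt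
    have cY : ContinuousOn Y (Icc 0 s) := fun t ht ↦ (h t ht).2.2.2.2.2.2.1.continuousWithinAt
    have cZ : ContinuousOn Z (Icc 0 s) := fun t ht ↦ (h t ht).2.2.2.2.2.2.2.continuousWithinAt
    fun_prop
  have hreach := reach_of_hasDerivWithinAt hf0.continuous hf1.continuous hf2.continuous hs.1.le
    (γ := fun t ↦ Φ (P t)) (w := fun t ↦ U (P t)) (hUc.comp_continuousOn hPc)
    (fun t ht ↦ by
      obtain ⟨hX, hY, hZ, hX', hY', -⟩ := h t ht
      rw [le_min_iff] at hX hY hZ hX' hY'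
      suffices hm : P t ∈ Metric.closedBall (0, 0, 0, φ1 v0, φ2 v0) η0 by
        have hlt : (U (P t)).1 ^ 2 + (U (P t)).2 ^ 2 < 1 := hball hm
        exact hlt.le
      rw [mem_closedBall_iff_norm, hP]
      simp only [Prod.mk_sub_mk, sub_zero, Prod.norm_def, Real.norm_eq_abs]
      exact max_le hX.1 (max_le hY.1 (max_le hZ.1 (max_le hX'.1 hY'.1))))
    (fun t ht ↦ by
      obtain ⟨hX, hY, hZ, hX', hY', dX, dY, dZ⟩ := h t ht
      rw [le_min_iff] at hX hY hZ
      have hω := (hiff (X t) (Y t) (Z t) hX.2 hY.2 hZ.2 (Φ (P t)) (by rw [hΦ, hP]) (X' t) (Y' t)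
        _).2 rfl
      have hVP : V (P t) = X' t • a + Y' t • b + (C (X t) (Y t) (Z t) + A (X t) (Y t) (Z t) * X' t
          + B (X t) (Y t) (Z t) * Y' t) • (a ⨯₃ b) := by rw [hV, hP]
      rw [← hVP] at hω
      have hUP := control_smul_add (hli _) hω
      have e : f0 (Φ (P t)) + (U (P t)).1 • f1 (Φ (P t)) + (U (P t)).2 • f2 (Φ (P t)) = V (P t) := by
        rw [add_assoc, hU, hUP, add_sub_cancel]
      rw [e, hVP]
      have hΦP : (fun t ↦ Φ (P t)) = fun t ↦ p + X t • a + Y t • b + Z t • (a ⨯₃ b) := by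
        rw [hΦ, hP]
        rfl
      rw [hΦP]
      exact (((dX.smul_const a).const_add p).add (dY.smul_const b)).add (dZ.smul_const (a ⨯₃ b)))
  have hΦs : Φ (P 0) = p := by
    rw [hΦ, hP]
    beta_reduce
    rw [hX0, hY0, hZ0]
    exact framePoint_zero p a b
  have hΦe : Φ (P s) = q τ := by
    rw [hqΦ τ, hΦ, hP]
    beta_reduce
    rw [hXs, hYs, hZs]
  rwa [hΦs, hΦe] at hreach

end LieShortcut

section Extremal

variable {f f0 f1 f2 g : E3 → E3}

lemma hasDerivAt_dot3 {a b : ℝ → E3} {a' b' : E3} {t : ℝ} (ha : HasDerivAt a a' t)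
    (hb : HasDerivAt b b' t) :
    HasDerivAt (fun s ↦ dot3 (a s) (b s)) (dot3 a' (b t) + dot3 (a t) b') t := by
  rw [hasDerivAt_pi] at *
  simp only [dot3, ← Finset.sum_add_distrib]
  exact HasDerivAt.fun_sum fun i _ ↦ (ha i).mul (hb i)

/-- The derivative of the Hamiltonian lift of `f` along a solution of the Hamiltonian system. -/
lemma hasDerivAt_hF {lam : ℝ → E3 × E3} {w : E3} {u : ℝ × ℝ} {t : ℝ}
    (hf : DifferentiableAt ℝ f (lam t).2)
    (hx : HasDerivAt (fun s ↦ (lam s).2)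
      (f0 (lam t).2 + u.1 • f1 (lam t).2 + u.2 • f2 (lam t).2) t)
    (hξ : HasDerivAt (fun s ↦ (lam s).1) w t)
    (hw : ∀ v, dot3 w v = -dot3 (lam t).1 (fderiv ℝ f0 (lam t).2 v
      + u.1 • fderiv ℝ f1 (lam t).2 v + u.2 • fderiv ℝ f2 (lam t).2 v)) :
    HasDerivAt (fun s ↦ hF f (lam s)) (hF (lie f0 f) (lam t) + u.1 * hF (lie f1 f) (lam t)
      + u.2 * hF (lie f2 f) (lam t)) t := by
  have hfx := hf.hasFDerivAt.comp_hasDerivAt t hx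
  refine (hasDerivAt_dot3 hξ hfx).congr_deriv ?_
  rw [Function.comp_apply, hw, map_add, map_add, map_smul, map_smul]
  simp only [hF, lie, dot3, Fin.sum_univ_three, Pi.add_apply, Pi.smul_apply, Pi.sub_apply,
    smul_eq_mul]
  ring

lemma continuous_hF (hf : Continuous f) : Continuous (hF f) := by
  have h : Continuous fun l : E3 × E3 ↦ f l.2 := hf.comp continuous_snd
  unfold hF dot3
  fun_prop

lemma continuous_lie (hf : ContDiff ℝ 1 f) (hg : ContDiff ℝ 1 g) : Continuous (lie f g) :=
  ((hg.continuous_fderiv one_ne_zero).clm_apply hf.continuous).sub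
    ((hf.continuous_fderiv one_ne_zero).clm_apply hg.continuous)

lemma hF_lie_self (l : E3 × E3) : hF (lie f f) l = 0 := by simp [hF, lie, dot3]

lemma hF_lie_comm (l : E3 × E3) : hF (lie f g) l = -hF (lie g f) l := by
  simp only [hF, lie, dot3, Fin.sum_univ_three, Pi.sub_apply]
  ring

/-- On the singular locus, `h₁₂ ≠ 0` makes `f1`, `f2`, `[f1, f2]` independent. -/
lemma cross_dotProduct_ne_zero {l : E3 × E3} {v : E3} (hl : l ∈ SingLocus f1 f2)
    (hli : LinearIndependent ℝ ![f1 l.2, f2 l.2]) (hv : dot3 l.1 v ≠ 0) :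
    dotProduct (crossProduct (f1 l.2) (f2 l.2)) v ≠ 0 := by
  intro h0
  have h := cross_decomposition (f1 l.2) (f2 l.2) v
  rw [h0, zero_smul, add_zero] at h
  have h1 := congrArg (dotProduct l.1) h
  have e1 : dotProduct l.1 (f1 l.2) = 0 := hl.1
  have e2 : dotProduct l.1 (f2 l.2) = 0 := hl.2
  rw [dotProduct_add, dotProduct_smul, dotProduct_smul, dotProduct_smul, e1, e2, smul_zero,
    smul_zero, add_zero, smul_eq_zero] at h1
  exact h1.elim (cross_dot_self_ne_zero hli) hv

/-- A time-optimal trajectory satisfies, at almost every time at which the control is interior to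
the disk, that `f1`, `f2`, `[f1, f2]` are dependent. -/
lemma TimeOpt.cross_dotProduct_lie_eq_zero (hf0 : ContDiff ℝ 1 f0) (hf1 : ContDiff ℝ 1 f1)
    (hf2 : ContDiff ℝ 1 f2) (hli : ∀ q, LinearIndependent ℝ ![f1 q, f2 q])
    {q : ℝ → E3} {u : ℝ → ℝ × ℝ} {t1 t : ℝ} (hopt : TimeOpt f0 f1 f2 q t1)
    (hq : IsTraj f0 f1 f2 u q (Icc 0 t1)) (hu : AdmControl u (Icc 0 t1)) (ht0 : 0 ≤ t)
    (ht1 : t < t1) (hd : HasDerivAt q (f0 (q t) + (u t).1 • f1 (q t) + (u t).2 • f2 (q t)) t)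
    (hut : (u t).1 ^ 2 + (u t).2 ^ 2 < 1) :
    dotProduct (crossProduct (f1 (q t)) (f2 (q t))) (lie f1 f2 (q t)) = 0 := by
  by_contra hn
  have hd' : HasDerivAt (fun r ↦ q (r + t))
      (f0 (q t) + (u t).1 • f1 (q t) + (u t).2 • f2 (q t)) 0 :=
    HasDerivAt.comp_add_const 0 t (by simpa using hd)
  obtain ⟨τ, hτ, s, hs, hreach⟩ := exists_faster_trajectory hf0 hf1 hf2 hli
    (sub_pos.2 ht1) (hq.shift ht0 le_rfl) (u0 := u t) hut (by simpa using hd') (by simpa using hn)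
  have hτ1 := hτ.2
  have hs0 := hs.1
  have hsτ := hs.2
  rw [zero_add] at hreach
  have h1 := hq.reach hu le_rfl ht1.le
  have h2 := hq.reach hu (a := τ + t) (by linarith [hτ.1]) le_rfl
  obtain ⟨v, γ, hv, hγ, h0, he⟩ := (h1.trans hreach (by linarith) hs0.le).trans h2 (by linarith)
    (by linarith)
  exact hopt.2.2 ⟨_, by linarith, by linarith, v, γ, hv, hγ, h0, he⟩

end Extremal

/-- **Proposition 3.4.** Under the nondegeneracy condition
`h₀₁² + h₀₂² + h₁₂² ≠ 0` at `λ̄ = (f₁(q̄) × f₂(q̄), q̄)` and `r² ≠ h₁₂²`, there is a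
neighbourhood `O` of `λ̄` such that no time-optimal trajectory admits an extremal
that remains in `Λ ∩ O` on some nondegenerate time interval `(τ₁, τ₂)`. -/
theorem statement2 (f0 f1 f2 : E3 → E3)
    (hf0 : ContDiff ℝ (⊤ : ℕ∞) f0) (hf1 : ContDiff ℝ (⊤ : ℕ∞) f1) (hf2 : ContDiff ℝ (⊤ : ℕ∞) f2)
    (hli : ∀ q : E3, LinearIndependent ℝ ![f1 q, f2 q])
    (qb : E3) (lb : E3 × E3) (h01 h02 h12 r : ℝ)
    (hlb : lb = (crossProduct (f1 qb) (f2 qb), qb))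
    (hh01 : h01 = hF (lie f0 f1) lb) (hh02 : h02 = hF (lie f0 f2) lb)
    (hh12 : h12 = hF (lie f1 f2) lb) (hr : r = Real.sqrt (h01 ^ 2 + h02 ^ 2))
    (hnondeg : h01 ^ 2 + h02 ^ 2 + h12 ^ 2 ≠ 0)
    (hneq : r ^ 2 ≠ h12 ^ 2) :
    ∃ O : Set (E3 × E3), IsOpen O ∧ lb ∈ O ∧
      ¬ ∃ (t1 : ℝ) (q : ℝ → E3) (u : ℝ → ℝ × ℝ) (lam : ℝ → E3 × E3) (τ1 τ2 : ℝ),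
          TimeOpt f0 f1 f2 q t1 ∧
          IsTraj f0 f1 f2 u q (Icc 0 t1) ∧
          IsExtremal f0 f1 f2 u lam (Icc 0 t1) ∧
          (∀ t ∈ Icc 0 t1, (lam t).2 = q t) ∧
          τ1 < τ2 ∧ Ioo τ1 τ2 ⊆ Icc 0 t1 ∧
          ∀ t ∈ Ioo τ1 τ2, lam t ∈ SingLocus f1 f2 ∩ O := by
  replace hf0 : ContDiff ℝ 1 f0 := hf0.of_le (by exact_mod_cast le_top)
  replace hf1 : ContDiff ℝ 1 f1 := hf1.of_le (by exact_mod_cast le_top)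
  replace hf2 : ContDiff ℝ 1 f2 := hf2.of_le (by exact_mod_cast le_top)
  have c01 := continuous_hF (continuous_lie hf0 hf1)
  have c02 := continuous_hF (continuous_lie hf0 hf2)
  have c12 := continuous_hF (continuous_lie hf1 hf2)
  refine ⟨{l | hF (lie f0 f1) l ^ 2 + hF (lie f0 f2) l ^ 2 ≠ hF (lie f1 f2) l ^ 2},
    isOpen_ne_fun (by fun_prop) (by fun_prop), ?_, ?_⟩
  · rw [mem_ofPred_eq, ← hh01, ← hh02, ← hh12]
    rwa [hr, Real.sq_sqrt (by positivity)] at hneq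
  rintro ⟨t1, q, u, lam, τ1, τ2, hopt, hq, ⟨-, hu, -, hext⟩, hlq, hττ, hsub, hsing⟩
  obtain ⟨t, ht, htq, htx⟩ : ∃ t ∈ Ioo τ1 τ2, (t ∈ Icc 0 t1 → HasDerivAt q _ t) ∧ _ := by
    have hfreq : ∃ᵐ t : ℝ, t ∈ Ioo τ1 τ2 :=
      frequently_ae_mem_iff.2 (by simpa [Real.volume_Ioo] using hττ)
    exact (hfreq.and_eventually (hq.2.and hext)).exists
  have htI := hsub ht
  obtain ⟨hx, ⟨w, hξ, hw⟩, -, -⟩ := htx htI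
  have hconst {f : E3 → E3} {c : ℝ} (hf : ∀ s ∈ Ioo τ1 τ2, hF f (lam s) = 0)
      (hc : HasDerivAt (fun s ↦ hF f (lam s)) c t) : c = 0 := by
    refine hc.unique ((hasDerivAt_const t (0 : ℝ)).congr_of_eventuallyEq ?_)
    filter_upwards [Ioo_mem_nhds ht.1 ht.2] with s hs using hf s hs
  have e1 := hconst (fun s hs ↦ (hsing s hs).1.1)
    (hasDerivAt_hF (hf1.differentiable one_ne_zero _) hx hξ hw)
  have e2 := hconst (fun s hs ↦ (hsing s hs).1.2)
    (hasDerivAt_hF (hf2.differentiable one_ne_zero _) hx hξ hw)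
  have hO : hF (lie f0 f1) (lam t) ^ 2 + hF (lie f0 f2) (lam t) ^ 2 ≠ hF (lie f1 f2) (lam t) ^ 2 :=
    (hsing t ht).2
  have hut : (u t).1 ^ 2 + (u t).2 ^ 2 ≤ 1 := hu.2 t htI
  rw [hF_lie_self, hF_lie_comm (f := f2)] at e1
  rw [hF_lie_self] at e2
  have hsq : hF (lie f0 f1) (lam t) ^ 2 + hF (lie f0 f2) (lam t) ^ 2
      = ((u t).1 ^ 2 + (u t).2 ^ 2) * hF (lie f1 f2) (lam t) ^ 2 := by
    rw [show hF (lie f0 f1) (lam t) = (u t).2 * hF (lie f1 f2) (lam t) by linarith,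
      show hF (lie f0 f2) (lam t) = -((u t).1 * hF (lie f1 f2) (lam t)) by linarith]
    ring
  rw [hsq] at hO
  have hne : hF (lie f1 f2) (lam t) ≠ 0 := fun h ↦ hO (by rw [h]; ring)
  have hlt : (u t).1 ^ 2 + (u t).2 ^ 2 < 1 := lt_of_le_of_ne hut fun h ↦ hO (by rw [h, one_mul])
  have htt1 : t < t1 := ht.2.trans_le (closure_minimal hsub isClosed_Icc
    (by rw [closure_Ioo hττ.ne]; exact right_mem_Icc.2 hττ.le)).2
  refine cross_dotProduct_ne_zero (hsing t ht).1 (hli _) hne ?_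
  rw [hlq t htI]
  exact hopt.cross_dotProduct_lie_eq_zero hf0 hf1 hf2 hli hq hu htI.1 htt1 (htq htI) hlt
end
end

section
/- Let τ > 0, let C ≤ 0 and 0 < c₂ ≤ c₁ be real constants, and let ρ, g, A : [0, τ] → ℝ be functions such that ρ is continuous and positive, g is continuous with c₂ ≤ g(t) ≤ c₁ for all t, A(t) ≥ C for all t, and the product t ↦ ρ(t) g(t) is differentiable on [0, τ] with derivative (ρg)'(t) = ρ(t) A(t). Then for all t ∈ [0, τ], ρ(t) ≥ (c₂/c₁) · e^{(C/c₂) t} · ρ(0). -/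
noncomputable section

open Real Set

/-- A differential form of Grönwall's inequality, bounding from below: if `f' ≥ K f` on `[a, b]`,
then `f t ≥ f a * exp (K * (t - a))` there. -/
theorem mul_exp_le_of_mul_le_hasDerivWithinAt {f f' : ℝ → ℝ} {K a b : ℝ}
    (hf : ∀ t ∈ Icc a b, HasDerivWithinAt f (f' t) (Icc a b) t)
    (hK : ∀ t ∈ Icc a b, K * f t ≤ f' t) {t : ℝ} (ht : t ∈ Icc a b) :
    f a * Real.exp (K * (t - a)) ≤ f t := by
  have hd : ∀ s ∈ Icc a b, HasDerivWithinAt (fun x => f x * Real.exp (-(K * (x - a))))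
      ((f' s - K * f s) * Real.exp (-(K * (s - a)))) (Icc a b) s := fun s hs => by
    have he : HasDerivAt (fun x : ℝ => -(K * (x - a))) (-(K * 1)) s :=
      (((hasDerivAt_id s).sub_const a).const_mul K).neg
    exact ((hf s hs).mul he.exp.hasDerivWithinAt).congr_deriv (by ring)
  have hmono : MonotoneOn (fun x => f x * Real.exp (-(K * (x - a)))) (Icc a b) :=
    monotoneOn_of_hasDerivWithinAt_nonneg (convex_Icc a b)
      (fun s hs => (hd s hs).continuousWithinAt)
      (fun s hs => (hd s (interior_subset hs)).mono interior_subset)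
      (fun s hs => mul_nonneg (sub_nonneg.2 (hK s (interior_subset hs))) (Real.exp_pos _).le)
  have h := hmono (left_mem_Icc.2 (ht.1.trans ht.2)) ht ht.1
  simp only [sub_self, mul_zero, neg_zero, Real.exp_zero, mul_one] at h
  rwa [Real.exp_neg, ← div_eq_mul_inv, le_div_iff₀ (Real.exp_pos _)] at h

/-- **key inequality in Lemma 4.4.** If `ρ > 0` is continuous,
`c₂ ≤ g ≤ c₁` with `0 < c₂ ≤ c₁`, `A ≥ C` with `C ≤ 0`, and `(ρ g)' = ρ A` on
`[0, τ]`, then `ρ(t) ≥ (c₂/c₁) e^{(C/c₂) t} ρ(0)` on `[0, τ]`. -/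
theorem statement8 (τ C c₁ c₂ : ℝ) (hτ : 0 < τ) (hC : C ≤ 0)
    (hc₂ : 0 < c₂) (hc : c₂ ≤ c₁)
    (ρ g A : ℝ → ℝ)
    (hρcont : ContinuousOn ρ (Icc 0 τ))
    (hρpos : ∀ t ∈ Icc 0 τ, 0 < ρ t)
    (hgcont : ContinuousOn g (Icc 0 τ))
    (hg : ∀ t ∈ Icc 0 τ, c₂ ≤ g t ∧ g t ≤ c₁)
    (hA : ∀ t ∈ Icc 0 τ, C ≤ A t)
    (hderiv : ∀ t ∈ Icc 0 τ,
      HasDerivWithinAt (fun s => ρ s * g s) (ρ t * A t) (Icc 0 τ) t) :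
    ∀ t ∈ Icc 0 τ, ρ t ≥ (c₂ / c₁) * Real.exp ((C / c₂) * t) * ρ 0 := by
  intro t ht
  have h0 : (0 : ℝ) ∈ Icc 0 τ := left_mem_Icc.2 hτ.le
  have hc₁ : 0 < c₁ := hc₂.trans_le hc
  have hbound : ∀ s ∈ Icc 0 τ, C / c₂ * (ρ s * g s) ≤ ρ s * A s := fun s hs => by
    have hle : C / c₂ * g s ≤ C := by
      calc C / c₂ * g s ≤ C / c₂ * c₂ :=
            mul_le_mul_of_nonpos_left (hg s hs).1 (div_nonpos_of_nonpos_of_nonneg hC hc₂.le)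
        _ = C := div_mul_cancel₀ C hc₂.ne'
    calc C / c₂ * (ρ s * g s) = ρ s * (C / c₂ * g s) := by ring
      _ ≤ ρ s * A s := mul_le_mul_of_nonneg_left (hle.trans (hA s hs)) (hρpos s hs).le
  have hgron := mul_exp_le_of_mul_le_hasDerivWithinAt hderiv hbound ht
  rw [sub_zero] at hgron
  have hmul : c₂ * Real.exp (C / c₂ * t) * ρ 0 ≤ ρ t * c₁ := by
    calc c₂ * Real.exp (C / c₂ * t) * ρ 0 = ρ 0 * c₂ * Real.exp (C / c₂ * t) := by ring
      _ ≤ ρ 0 * g 0 * Real.exp (C / c₂ * t) := by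
          gcongr
          · exact (hρpos 0 h0).le
          · exact (hg 0 h0).1
      _ ≤ ρ t * g t := hgron
      _ ≤ ρ t * c₁ := mul_le_mul_of_nonneg_left (hg t ht).2 (hρpos t ht).le
  calc c₂ / c₁ * Real.exp (C / c₂ * t) * ρ 0 = c₂ * Real.exp (C / c₂ * t) * ρ 0 / c₁ := by ring
    _ ≤ ρ t := (div_le_iff₀ hc₁).2 hmul
end
end
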